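/- arXiv:1610.06935 — 2 statements merged into one kernel-verified Lean document; each statement's English description precedes it below -/
import Mathlib

section
/- The sum of four squares is universal over the ring of integers of ℚ(√5): every totally positive element of ℤ[(1+√5)/2] can be written as x₁² + x₂² + x₃² + x₄² with xᵢ ∈ ℤ[(1+√5)/2]. -/
/-- The two real embeddings of `ℤ[(1+√5)/2]`, with elements encoded as pairs
`(a, b) ↔ a + b·(1+√5)/2`; `s` is `√5` or `-√5`. -/
noncomputable def goldEmb (s : ℝ) (x : ℤ × ℤ) : ℝ :=
  (x.1 : ℝ) + (x.2 : ℝ) * ((1 + s) / 2)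

namespace Gold

open QuadraticAlgebra

/-- The ring `ℤ[(1+√5)/2]`. -/
abbrev R5 := QuadraticAlgebra ℤ 1 1

/-- The golden ratio as an element of `R5`. -/
def ph : R5 := ⟨0, 1⟩

lemma ph_sq : ph ^ 2 = ph + 1 := by
  rw [pow_two]
  ext <;> simp [ph]

lemma nrm (z : R5) : z.norm = z.re * z.re + z.re * z.im - z.im * z.im := by
  rw [norm_def]; ring

/-- The ring homomorphism to `ℝ` attached to a square root `s` of five. -/
noncomputable def emb (s : ℝ) (hs : s * s = 5) : R5 →+* ℝ where
  toFun z := (z.re : ℝ) + (z.im : ℝ) * ((1 + s) / 2)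
  map_one' := by simp
  map_zero' := by simp
  map_add' x y := by simp; ring
  map_mul' x y := by
    simp
    linear_combination (-(x.im : ℝ) * y.im / 4) * hs

lemma s5 : Real.sqrt 5 * Real.sqrt 5 = 5 := Real.mul_self_sqrt (by norm_num)
lemma s5' : (-Real.sqrt 5) * (-Real.sqrt 5) = 5 := by rw [neg_mul_neg]; exact s5

noncomputable def e₁ : R5 →+* ℝ := emb (Real.sqrt 5) s5
noncomputable def e₂ : R5 →+* ℝ := emb (-Real.sqrt 5) s5'

lemma e₁_def (z : R5) : e₁ z = (z.re : ℝ) + (z.im : ℝ) * ((1 + Real.sqrt 5) / 2) := rfl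
lemma e₂_def (z : R5) : e₂ z = (z.re : ℝ) + (z.im : ℝ) * ((1 + -Real.sqrt 5) / 2) := rfl

lemma e_mul (z : R5) : e₁ z * e₂ z = (z.norm : ℝ) := by
  rw [e₁_def, e₂_def, nrm]
  push_cast
  linear_combination (-(z.im : ℝ) ^ 2 / 4) * s5

lemma norm_zero_iff (z : R5) (h : z.norm = 0) : z = 0 := by
  rw [nrm] at h
  have hb : z.im = 0 := by
    by_contra hb
    have hi : Irrational (Real.sqrt 5) := by
      simpa using Nat.Prime.irrational_sqrt (p := 5) (by norm_num)
    apply hi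
    refine ⟨|(2 * z.re + z.im : ℚ) / z.im|, ?_⟩
    have hb' : (z.im : ℝ) ≠ 0 := by exact_mod_cast hb
    have h' : (z.re : ℝ) * z.re + z.re * z.im - z.im * z.im = 0 := by exact_mod_cast h
    push_cast
    rw [← Real.sqrt_sq_eq_abs]
    congr 1
    field_simp
    linear_combination 4 * h'
  have ha : z.re = 0 := by
    rw [hb] at h
    simpa using h
  ext <;> simp [ha, hb]

instance : IsDomain R5 := by
  have : NoZeroDivisors R5 := ⟨by
    intro a b h
    have := congrArg QuadraticAlgebra.norm h
    rw [map_mul, QuadraticAlgebra.norm_zero, mul_eq_zero] at this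
    exact this.imp (norm_zero_iff _) (norm_zero_iff _)⟩
  exact NoZeroDivisors.to_isDomain _

lemma norm_ne {z : R5} (h : z ≠ 0) : z.norm ≠ 0 := fun h' => h (norm_zero_iff z h')

lemma star_mul_self' (z : R5) : star z * z = ((z.norm : ℤ) : R5) := by
  rw [mul_comm, ← algebraMap_norm_eq_mul_star]; rfl

lemma e₁_inj {z : R5} (h : e₁ z = 0) : z = 0 := by
  apply norm_zero_iff
  have := e_mul z
  rw [h, zero_mul] at this
  exact_mod_cast this.symm

lemma e₂_inj {z : R5} (h : e₂ z = 0) : z = 0 := by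
  apply norm_zero_iff
  have := e_mul z
  rw [h, mul_zero] at this
  exact_mod_cast this.symm

/-- Totally positive. -/
def TP (z : R5) : Prop := 0 < e₁ z ∧ 0 < e₂ z

lemma TP.norm_pos {z : R5} (h : TP z) : 0 < z.norm := by
  have := mul_pos h.1 h.2
  rw [e_mul] at this
  exact_mod_cast this

lemma TP.ne {z : R5} (h : TP z) : z ≠ 0 := by
  rintro rfl
  have := h.1
  simp at this

lemma TP.mul {x y : R5} (hx : TP x) (hy : TP y) : TP (x * y) := by
  constructor
  · rw [map_mul]; exact mul_pos hx.1 hy.1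
  · rw [map_mul]; exact mul_pos hx.2 hy.2

lemma TP.of_mul {x y : R5} (hx : TP x) (hxy : TP (x * y)) : TP y := by
  obtain ⟨h1, h2⟩ := hxy
  rw [map_mul] at h1 h2
  exact ⟨pos_of_mul_pos_right h1 hx.1.le, pos_of_mul_pos_right h2 hx.2.le⟩

lemma tp_or {z : R5} (h : 0 < z.norm) : TP z ∨ TP (-z) := by
  have : 0 < e₁ z * e₂ z := by rw [e_mul]; exact_mod_cast h
  rcases mul_pos_iff.1 this with h | h
  · exact Or.inl h
  · right
    constructor
    · rw [map_neg]; linarith [h.1]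
    · rw [map_neg]; linarith [h.2]

lemma sum_zero {a b c d : R5} (h : a ^ 2 + b ^ 2 + c ^ 2 + d ^ 2 = 0) :
    a = 0 ∧ b = 0 ∧ c = 0 ∧ d = 0 := by
  have h' := congrArg e₁ h
  simp only [map_add, map_pow, map_zero] at h'
  refine ⟨e₁_inj ?_, e₁_inj ?_, e₁_inj ?_, e₁_inj ?_⟩ <;> rw [← sq_eq_zero_iff] <;>
    nlinarith [sq_nonneg (e₁ a), sq_nonneg (e₁ b), sq_nonneg (e₁ c), sq_nonneg (e₁ d)]

lemma sum_tp {a b c d : R5} (h : a ^ 2 + b ^ 2 + c ^ 2 + d ^ 2 ≠ 0) :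
    TP (a ^ 2 + b ^ 2 + c ^ 2 + d ^ 2) := by
  constructor
  · refine lt_of_le_of_ne ?_ (fun h' => h (e₁_inj h'.symm))
    simp only [map_add, map_pow]; positivity
  · refine lt_of_le_of_ne ?_ (fun h' => h (e₂_inj h'.symm))
    simp only [map_add, map_pow]; positivity

lemma tp_four : TP (4 : R5) := by
  constructor <;> (rw [map_ofNat]; norm_num)

/-! ### Totally positive units are squares -/

lemma unit_sq_aux (n : ℕ) : ∀ a b : ℤ, b.natAbs ≤ n → 0 < 2 * a + b →
    a * a + a * b - b * b = 1 → ∃ z : R5, (⟨a, b⟩ : R5) = z ^ 2 := by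
  induction n with
  | zero =>
    intro a b hb ht hn
    have hb0 : b = 0 := by omega
    subst hb0
    have : a = 1 := by nlinarith
    subst this
    exact ⟨1, by rw [one_pow]; rfl⟩
  | succ n ih =>
    intro a b hb ht hn
    rcases lt_trichotomy b 0 with h | h | h
    · have ha : 0 < a := by omega
      have hab : -b < a := by nlinarith
      have hab2 : a < -3 * b := by nlinarith
      have hab3 : 0 < 3 * a + 4 * b := by nlinarith
      obtain ⟨z, hz⟩ := ih (a + b) (a + 2 * b) (by omega) (by omega) (by nlinarith)
      refine ⟨(ph - 1) * z, ?_⟩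
      rw [mul_pow, ← hz, pow_two]
      ext <;> simp [ph] <;> ring
    · subst h
      have : a = 1 := by nlinarith
      subst this
      exact ⟨1, by rw [one_pow]; rfl⟩
    · have ha : 0 < a := by
        by_contra ha
        have h1 : a * (a + b) > 0 := by nlinarith
        have h2 : a < 0 := by
          rcases eq_or_lt_of_le (not_lt.1 ha) with h | h
          · rw [h] at h1; simp at h1
          · exact h
        nlinarith
      have hab : a ≤ b := by nlinarith
      have hab3 : 0 < 3 * a - b := by nlinarith
      obtain ⟨z, hz⟩ := ih (2 * a - b) (b - a) (by omega) (by omega) (by nlinarith)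
      refine ⟨ph * z, ?_⟩
      rw [mul_pow, ← hz, pow_two]
      ext <;> simp [ph] <;> ring

lemma unit_sq {u : R5} (hu : TP u) (hn : u.norm = 1) : ∃ z : R5, u = z ^ 2 := by
  have h1 := hu.1
  have h2 := hu.2
  rw [e₁_def] at h1
  rw [e₂_def] at h2
  have h3 : (0 : ℝ) < 2 * u.re + u.im := by linarith
  rw [nrm] at hn
  exact unit_sq_aux _ u.re u.im le_rfl (by exact_mod_cast h3) hn

/-! ### Euclidean division in `R5` -/

lemma round_int (t n : ℤ) (hn : n ≠ 0) : ∃ w w' : ℤ, 4 * (t - n * w) ^ 2 ≤ n ^ 2 ∧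
    (t - n * w') ^ 2 ≤ n ^ 2 ∧ (w' - w) % 2 = 1 := by
  have key : ∀ n : ℤ, 0 < n → ∃ w w' : ℤ, 4 * (t - n * w) ^ 2 ≤ n ^ 2 ∧
      (t - n * w') ^ 2 ≤ n ^ 2 ∧ (w' - w) % 2 = 1 := by
    intro n hn
    have h1 := Int.emod_nonneg t hn.ne'
    have h2 := Int.emod_lt_of_pos t hn
    have h3 := Int.emod_add_mul_ediv t n
    by_cases h : 2 * (t % n) ≤ n
    · refine ⟨t / n, t / n + 1, ?_, ?_, by omega⟩
      · have : t - n * (t / n) = t % n := by linarith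
        rw [this]; nlinarith
      · have : t - n * (t / n + 1) = t % n - n := by linarith
        rw [this]; nlinarith
    · refine ⟨t / n + 1, t / n, ?_, ?_, by omega⟩
      · have : t - n * (t / n + 1) = t % n - n := by linarith
        rw [this]; nlinarith
      · have : t - n * (t / n) = t % n := by linarith
        rw [this]; nlinarith
  rcases lt_or_gt_of_ne hn with h | h
  · obtain ⟨w, w', h1, h2, h3⟩ := key (-n) (by omega)
    refine ⟨-w, -w', ?_, ?_, by omega⟩
    · convert h1 using 1 <;> ring
    · convert h2 using 1 <;> ring
  · exact key n h

lemma re_subn (t : R5) (n x y : ℤ) : (t - (n : R5) * ⟨x, y⟩).re = t.re - n * x := by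
  simp

lemma im_subn (t : R5) (n x y : ℤ) : (t - (n : R5) * ⟨x, y⟩).im = t.im - n * y := by
  simp

lemma star_sub (a k w : R5) : star k * (a - k * w) = star k * a - (k.norm : R5) * w := by
  rw [← star_mul_self']; ring

lemma div_R5 (a k : R5) (hk : k ≠ 0) : ∃ q : R5, |(a - k * q).norm| < |k.norm| := by
  have hn := norm_ne hk
  obtain ⟨w0, -, h0, -, -⟩ := round_int (star k * a).re k.norm hn
  obtain ⟨w1, -, h1, -, -⟩ := round_int (star k * a).im k.norm hn
  refine ⟨⟨w0, w1⟩, ?_⟩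
  have hN := congrArg QuadraticAlgebra.norm (star_sub a k ⟨w0, w1⟩)
  rw [map_mul, QuadraticAlgebra.norm_star, nrm (star k * a - _), re_subn, im_subn] at hN
  generalize (star k * a).re - k.norm * w0 = x at *
  generalize (star k * a).im - k.norm * w1 = y at *
  generalize (a - k * ⟨w0, w1⟩ : R5).norm = M at *
  generalize k.norm = n at *
  have : n ^ 2 > 0 := by positivity
  have hle : |n| * |M| < |n| * |n| := by
    rw [← abs_mul, hN, abs_mul_abs_self, abs_lt]
    constructor <;> nlinarith [sq_nonneg (x + y), sq_nonneg (x - y)]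
  exact lt_of_mul_lt_mul_left hle (abs_nonneg _)

@[reducible]
noncomputable def eucl : EuclideanDomain R5 :=
  { (inferInstance : CommRing R5), (inferInstance : Nontrivial R5) with
    quotient := fun a b => if h : b = 0 then 0 else (div_R5 a b h).choose
    remainder := fun a b => a - b * (if h : b = 0 then 0 else (div_R5 a b h).choose)
    quotient_zero := fun a => by simp
    quotient_mul_add_remainder_eq := fun a b => by ring
    r := fun a b => a.norm.natAbs < b.norm.natAbs
    r_wellFounded := (measure (fun a : R5 => a.norm.natAbs)).wf
    remainder_lt := fun a b hb => by
      have := (div_R5 a b hb).choose_spec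
      rw [dif_neg hb]
      zify
      exact this
    mul_left_not_lt := fun a b hb => by
      rw [map_mul, Int.natAbs_mul]
      have := norm_ne hb
      apply not_lt_of_ge
      exact Nat.le_mul_of_pos_right _ (Int.natAbs_pos.2 this) }

instance : IsPrincipalIdealRing R5 := @EuclideanDomain.to_principal_ideal_domain R5 eucl

lemma irr_prime {p : R5} (h : Irreducible p) : Prime p := h.prime

lemma exists_nat_prime {q : R5} (hq : Prime q) (n : ℕ) (hn : n ≠ 0) (h : q ∣ (n : R5)) :
    ∃ p : ℕ, p.Prime ∧ q ∣ (p : R5) := by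
  induction n using induction_on_primes with
  | zero => exact absurd rfl hn
  | one => exact absurd (isUnit_of_dvd_one (by simpa using h)) hq.not_isUnit
  | prime_mul p a hp ih =>
    rw [Nat.cast_mul] at h
    rcases hq.dvd_or_dvd h with h | h
    · exact ⟨p, hp, h⟩
    · exact ih (by rintro rfl; simp at hn) h

lemma exists_xy {q : R5} (hq : Irreducible q) : ∃ x y k : R5, 1 + x ^ 2 + y ^ 2 = q * k := by
  have h1 : q ∣ ((q.norm.natAbs : ℕ) : R5) := by
    have h2 : q ∣ ((q.norm : ℤ) : R5) := ⟨star q, by rw [← star_mul_self']; ring⟩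
    rcases Int.natAbs_eq q.norm with h | h
    · rw [h] at h2; simpa using h2
    · rw [h] at h2; simpa using h2
  obtain ⟨p, hp, hqp⟩ := exists_nat_prime (irr_prime hq) _
    (Int.natAbs_ne_zero.2 (norm_ne hq.ne_zero)) h1
  have : Fact p.Prime := ⟨hp⟩
  obtain ⟨a, b, -, -, hab⟩ := Nat.sq_add_sq_zmodEq p (-1)
  obtain ⟨c, hc⟩ := hab.symm.dvd
  obtain ⟨d, hd⟩ := hqp
  refine ⟨a, b, d * c, ?_⟩
  have hc' : ((a : ℤ) ^ 2 + (b : ℤ) ^ 2 - (-1) : ℤ) = ((p * c : ℤ)) := hc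
  have := congrArg (Int.cast : ℤ → R5) hc'
  push_cast at this
  rw [hd] at this
  linear_combination this

/-! ### The icosian code -/

/-- `(a, b, c, d) / 2` is an icosian. -/
def Code (a b c d : R5) : Prop :=
  ∃ r s : R5, c = a + ph * (b - a) + 2 * r ∧ d = b + ph * (b - a) + 2 * s

lemma Code.add {a b c d a' b' c' d' : R5} (h : Code a b c d) (h' : Code a' b' c' d') :
    Code (a + a') (b + b') (c + c') (d + d') := by
  obtain ⟨r, s, h1, h2⟩ := h
  obtain ⟨r', s', h1', h2'⟩ := h'
  exact ⟨r + r', s + s', by rw [h1, h1']; ring, by rw [h2, h2']; ring⟩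

lemma Code.smul {a b c d : R5} (z : R5) (h : Code a b c d) :
    Code (z * a) (z * b) (z * c) (z * d) := by
  obtain ⟨r, s, h1, h2⟩ := h
  exact ⟨z * r, z * s, by rw [h1]; ring, by rw [h2]; ring⟩

lemma code_two (a b c d : R5) : Code (2 * a) (2 * b) (2 * c) (2 * d) :=
  ⟨c - a - ph * (b - a), d - b - ph * (b - a), by ring, by ring⟩

section generic
variable {A : Type*} [CommRing A]

def mulP (φ p₁ q₁ r₁ s₁ p₂ q₂ r₂ s₂ : A) : A :=
  (2)*p₁*p₂ +
    (-1-1*φ)*p₁*q₂ +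
    (1-1*φ)*p₁*r₂ +
    (-1*φ)*p₁*s₂ +
    (-1-1*φ)*q₁*p₂ +
    (2+2*φ)*q₁*q₂ +
    (1*φ)*q₁*r₂ +
    (1+1*φ)*q₁*s₂ +
    (1-1*φ)*r₁*p₂ +
    (1*φ)*r₁*q₂ +
    (2)*r₁*r₂ +
    (-1*φ)*s₁*p₂ +
    (1+1*φ)*s₁*q₂ +
    (2)*s₁*s₂
def mulQ (φ p₁ q₁ r₁ s₁ p₂ q₂ r₂ s₂ : A) : A :=
  (-1*φ)*p₁*r₂ +
    (-1+1*φ)*p₁*s₂ +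
    (1+1*φ)*q₁*r₂ +
    (-1*φ)*q₁*s₂ +
    (1*φ)*r₁*p₂ +
    (-1-1*φ)*r₁*q₂ +
    (-2)*r₁*s₂ +
    (1-1*φ)*s₁*p₂ +
    (1*φ)*s₁*q₂ +
    (2)*s₁*r₂
def mulR (φ p₁ q₁ r₁ s₁ p₂ q₂ r₂ s₂ : A) : A :=
  (-1+1*φ)*p₁*p₂ +
    (1*φ)*p₁*r₂ +
    (-1)*p₁*s₂ +
    (-1*φ)*q₁*p₂ +
    (1*φ)*q₁*q₂ +
    (-1*φ)*q₁*r₂ +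
    (1+1*φ)*q₁*s₂ +
    (-2)*r₁*p₂ +
    (1+1*φ)*r₁*q₂ +
    (-1+1*φ)*r₁*r₂ +
    (1*φ)*r₁*s₂ +
    (-1)*s₁*q₂ +
    (-1*φ)*s₁*r₂ +
    (-1+1*φ)*s₁*s₂
def mulS (φ p₁ q₁ r₁ s₁ p₂ q₂ r₂ s₂ : A) : A :=
  (1*φ)*p₁*p₂ +
    (-1*φ)*p₁*q₂ +
    (1*φ)*p₁*r₂ +
    (-1*φ)*p₁*s₂ +
    (-1-1*φ)*q₁*p₂ +
    (1+2*φ)*q₁*q₂ +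
    (-1-1*φ)*q₁*r₂ +
    (1+2*φ)*q₁*s₂ +
    (-1-1*φ)*r₁*p₂ +
    (2+2*φ)*r₁*q₂ +
    (1*φ)*r₁*r₂ +
    (1+1*φ)*r₁*s₂ +
    (-1)*s₁*p₂ +
    (-1-1*φ)*s₁*r₂ +
    (1*φ)*s₁*s₂
def nm (φ p q r s : A) : A :=
  (1)*p*p +
    (-1-1*φ)*p*q +
    (1-1*φ)*p*r +
    (-1*φ)*p*s +
    (1+1*φ)*q*q +
    (1*φ)*q*r +
    (1+1*φ)*q*s +
    (1)*r*r +
    (1)*s*s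
end generic

lemma code_norm (p q r s : R5) :
    p ^ 2 + q ^ 2 + (p + ph * (q - p) + 2 * r) ^ 2 + (q + ph * (q - p) + 2 * s) ^ 2 =
      4 * nm ph p q r s := by
  unfold nm
  linear_combination (2 * (q - p) ^ 2) * ph_sq

lemma Code.norm {a b c d : R5} (h : Code a b c d) :
    ∃ n, a ^ 2 + b ^ 2 + c ^ 2 + d ^ 2 = 4 * n := by
  obtain ⟨r, s, rfl, rfl⟩ := h
  exact ⟨_, code_norm _ _ _ _⟩

lemma code_mul (p₁ q₁ r₁ s₁ p₂ q₂ r₂ s₂ y2 y3 x2 x3 : R5)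
    (hy2 : y2 = p₁ + ph * (q₁ - p₁) + 2 * r₁) (hy3 : y3 = q₁ + ph * (q₁ - p₁) + 2 * s₁)
    (hx2 : x2 = p₂ + ph * (q₂ - p₂) + 2 * r₂) (hx3 : x3 = q₂ + ph * (q₂ - p₂) + 2 * s₂)
    (P Q R S : R5) (hP : P = mulP ph p₁ q₁ r₁ s₁ p₂ q₂ r₂ s₂)
    (hQ : Q = mulQ ph p₁ q₁ r₁ s₁ p₂ q₂ r₂ s₂)
    (hR : R = mulR ph p₁ q₁ r₁ s₁ p₂ q₂ r₂ s₂)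
    (hS : S = mulS ph p₁ q₁ r₁ s₁ p₂ q₂ r₂ s₂) :
    p₁ * p₂ + q₁ * q₂ + y2 * x2 + y3 * x3 = 2 * P ∧
    p₁ * q₂ - q₁ * p₂ - y2 * x3 + y3 * x2 = 2 * Q ∧
    p₁ * x2 + q₁ * x3 - y2 * p₂ - y3 * q₂ = 2 * (P + ph * (Q - P) + 2 * R) ∧
    p₁ * x3 - q₁ * x2 + y2 * q₂ - y3 * p₂ = 2 * (Q + ph * (Q - P) + 2 * S) := by
  have h := ph_sq
  subst hP hQ hR hS hy2 hy3 hx2 hx3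
  unfold mulP mulQ mulR mulS
  generalize ph = φ at *
  refine ⟨?_, ?_, ?_, ?_⟩ <;> grind

lemma cover (s1 s2 s3 s4 : ℤ) : ∃ t0 t1 t2 t3 t4 t5 t6 t7 : ℤ,
    ((t0 = 0 ∨ t0 = 1) ∧ (t1 = 0 ∨ t1 = 1) ∧ (t2 = 0 ∨ t2 = 1) ∧ (t3 = 0 ∨ t3 = 1) ∧
    (t4 = 0 ∨ t4 = 1) ∧ (t5 = 0 ∨ t5 = 1) ∧ (t6 = 0 ∨ t6 = 1) ∧ (t7 = 0 ∨ t7 = 1)) ∧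
    t0 + t1 + t2 + t3 + t4 + t5 + t6 + t7 ≤ 2 ∧
    (s1 + t0 + t3 + t4 + t5) % 2 = 0 ∧
    (s2 + t0 + t1 + t2 + t5) % 2 = 0 ∧
    (s3 + t1 + t2 + t6 + t7) % 2 = 0 ∧
    (s4 + t0 + t2 + t3 + t7) % 2 = 0 := by
  rcases Int.emod_two_eq_zero_or_one s1 with h1 | h1 <;>
  rcases Int.emod_two_eq_zero_or_one s2 with h2 | h2 <;>
  rcases Int.emod_two_eq_zero_or_one s3 with h3 | h3 <;>
  rcases Int.emod_two_eq_zero_or_one s4 with h4 | h4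
  · exact ⟨0, 0, 0, 0, 0, 0, 0, 0, by omega⟩
  · exact ⟨1, 0, 0, 0, 0, 1, 0, 0, by omega⟩
  · exact ⟨0, 0, 0, 0, 0, 0, 1, 0, by omega⟩
  · exact ⟨0, 0, 0, 0, 0, 0, 0, 1, by omega⟩
  · exact ⟨1, 0, 0, 1, 0, 0, 0, 0, by omega⟩
  · exact ⟨1, 0, 0, 0, 1, 0, 0, 0, by omega⟩
  · exact ⟨0, 1, 0, 0, 0, 0, 0, 0, by omega⟩
  · exact ⟨0, 0, 1, 0, 0, 0, 0, 0, by omega⟩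
  · exact ⟨0, 0, 0, 0, 1, 0, 0, 0, by omega⟩
  · exact ⟨0, 0, 0, 1, 0, 0, 0, 0, by omega⟩
  · exact ⟨1, 0, 1, 0, 0, 0, 0, 0, by omega⟩
  · exact ⟨1, 1, 0, 0, 0, 0, 0, 0, by omega⟩
  · exact ⟨0, 0, 0, 0, 0, 1, 0, 0, by omega⟩
  · exact ⟨1, 0, 0, 0, 0, 0, 0, 0, by omega⟩
  · exact ⟨1, 0, 0, 0, 0, 0, 0, 1, by omega⟩
  · exact ⟨1, 0, 0, 0, 0, 0, 1, 0, by omega⟩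

lemma code_of_parity (a0 a1 b0 b1 c0 c1 d0 d1 : ℤ) (h1 : (c0 + a0 + b1 + a1) % 2 = 0)
    (h2 : (c1 + b0 + b1 + a0) % 2 = 0) (h3 : (d0 + b0 + b1 + a1) % 2 = 0)
    (h4 : (d1 + b0 + a0 + a1) % 2 = 0) :
    Code ⟨a0, a1⟩ ⟨b0, b1⟩ ⟨c0, c1⟩ ⟨d0, d1⟩ := by
  refine ⟨⟨(c0 - a0 - b1 + a1) / 2, (c1 - b0 - b1 + a0) / 2⟩,
    ⟨(d0 - b0 - b1 + a1) / 2, (d1 - b0 - 2 * b1 + a0 + a1) / 2⟩, ?_, ?_⟩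
  · ext <;> simp [ph] <;> omega
  · ext <;> simp [ph] <;> omega

/-- Choose between the nearest integer and the nearest one of the other parity. -/
lemma choose_bound {t n w w' e : ℤ} (h : 4 * (t - n * w) ^ 2 ≤ n ^ 2)
    (h' : (t - n * w') ^ 2 ≤ n ^ 2) (hp : (w' - w) % 2 = 1) (he : e = 0 ∨ e = 1) :
    ∃ v : ℤ, 4 * (t - n * v) ^ 2 ≤ (1 + 3 * e) * n ^ 2 ∧ (v - w - e) % 2 = 0 := by
  rcases he with rfl | rfl
  · exact ⟨w, by linarith, by omega⟩
  · exact ⟨w', by linarith, by omega⟩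

lemma T_bound (y : R5) : 4 * y.norm ≤ 5 * (y.re + y.im) ^ 2 := by
  rw [nrm]
  nlinarith [sq_nonneg (y.re + 3 * y.im)]

lemma T_sq (x : R5) : (x ^ 2).re + (x ^ 2).im = (x.re + x.im) ^ 2 + x.im ^ 2 := by
  rw [pow_two]; simp; ring

set_option maxHeartbeats 2000000 in
lemma div_code (a b c d k : R5) (hk : k ≠ 0) : ∃ w0 w1 w2 w3 : R5, Code w0 w1 w2 w3 ∧
    ((a - k * w0) ^ 2 + (b - k * w1) ^ 2 + (c - k * w2) ^ 2 + (d - k * w3) ^ 2).norm <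
      16 * k.norm ^ 2 := by
  have hn := norm_ne hk
  obtain ⟨u0, u0', h0, h0', p0⟩ :=
    round_int ((star k * a).re + (star k * a).im) k.norm hn
  obtain ⟨u1, u1', h1, h1', p1⟩ := round_int (star k * a).im k.norm hn
  obtain ⟨u2, u2', h2, h2', p2⟩ :=
    round_int ((star k * b).re + (star k * b).im) k.norm hn
  obtain ⟨u3, u3', h3, h3', p3⟩ := round_int (star k * b).im k.norm hn
  obtain ⟨u4, u4', h4, h4', p4⟩ :=
    round_int ((star k * c).re + (star k * c).im) k.norm hn
  obtain ⟨u5, u5', h5, h5', p5⟩ := round_int (star k * c).im k.norm hn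
  obtain ⟨u6, u6', h6, h6', p6⟩ :=
    round_int ((star k * d).re + (star k * d).im) k.norm hn
  obtain ⟨u7, u7', h7, h7', p7⟩ := round_int (star k * d).im k.norm hn
  obtain ⟨t0, t1, t2, t3, t4, t5, t6, t7, ⟨q0, q1, q2, q3, q4, q5, q6, q7⟩, hs, e1, e2, e3, e4⟩ :=
    cover (u0 + u3 + u4 + u5) (u0 + u1 + u2 + u5) (u1 + u2 + u6 + u7) (u0 + u2 + u3 + u7)
  obtain ⟨v0, b0, m0⟩ := choose_bound h0 h0' p0 q0
  obtain ⟨v1, b1, m1⟩ := choose_bound h1 h1' p1 q1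
  obtain ⟨v2, b2, m2⟩ := choose_bound h2 h2' p2 q2
  obtain ⟨v3, b3, m3⟩ := choose_bound h3 h3' p3 q3
  obtain ⟨v4, b4, m4⟩ := choose_bound h4 h4' p4 q4
  obtain ⟨v5, b5, m5⟩ := choose_bound h5 h5' p5 q5
  obtain ⟨v6, b6, m6⟩ := choose_bound h6 h6' p6 q6
  obtain ⟨v7, b7, m7⟩ := choose_bound h7 h7' p7 q7
  refine ⟨⟨v0 - v1, v1⟩, ⟨v2 - v3, v3⟩, ⟨v4 - v5, v5⟩, ⟨v6 - v7, v7⟩,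
    code_of_parity _ _ _ _ _ _ _ _ (by omega) (by omega) (by omega) (by omega), ?_⟩
  clear h0 h0' p0 q0 h1 h1' p1 q1 h2 h2' p2 q2 h3 h3' p3 q3 h4 h4' p4 q4 h5 h5' p5 q5
    h6 h6' p6 q6 h7 h7' p7 q7 m0 m1 m2 m3 m4 m5 m6 m7 e1 e2 e3 e4
  set Y := (a - k * ⟨v0 - v1, v1⟩) ^ 2 + (b - k * ⟨v2 - v3, v3⟩) ^ 2 +
    (c - k * ⟨v4 - v5, v5⟩) ^ 2 + (d - k * ⟨v6 - v7, v7⟩) ^ 2 with hY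
  have hE : star k ^ 2 * Y = (star k * a - (k.norm : R5) * ⟨v0 - v1, v1⟩) ^ 2 +
      (star k * b - (k.norm : R5) * ⟨v2 - v3, v3⟩) ^ 2 +
      (star k * c - (k.norm : R5) * ⟨v4 - v5, v5⟩) ^ 2 +
      (star k * d - (k.norm : R5) * ⟨v6 - v7, v7⟩) ^ 2 := by
    rw [hY, ← star_sub, ← star_sub, ← star_sub, ← star_sub]; ring
  have hT : 4 * ((star k ^ 2 * Y).re + (star k ^ 2 * Y).im) ≤ 14 * k.norm ^ 2 := by
    have hn2 : 0 ≤ k.norm ^ 2 := sq_nonneg _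
    have := mul_le_mul_of_nonneg_right hs hn2
    have expand : ∀ x y z w : R5, (x ^ 2 + y ^ 2 + z ^ 2 + w ^ 2).re +
        (x ^ 2 + y ^ 2 + z ^ 2 + w ^ 2).im = ((x ^ 2).re + (x ^ 2).im) +
        ((y ^ 2).re + (y ^ 2).im) + ((z ^ 2).re + (z ^ 2).im) + ((w ^ 2).re + (w ^ 2).im) := by
      intro x y z w
      simp only [re_add, im_add]; ring
    rw [hE, expand, T_sq, T_sq, T_sq, T_sq]
    simp only [re_subn, im_subn]
    nlinarith
  have hT0 : 0 ≤ (star k ^ 2 * Y).re + (star k ^ 2 * Y).im := by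
    rw [hE]
    simp only [re_add, im_add]
    nlinarith [T_sq (star k * a - (k.norm : R5) * ⟨v0 - v1, v1⟩),
      T_sq (star k * b - (k.norm : R5) * ⟨v2 - v3, v3⟩),
      T_sq (star k * c - (k.norm : R5) * ⟨v4 - v5, v5⟩),
      T_sq (star k * d - (k.norm : R5) * ⟨v6 - v7, v7⟩)]
  have hB := T_bound (star k ^ 2 * Y)
  rw [map_mul, map_pow, QuadraticAlgebra.norm_star] at hB
  generalize (star k ^ 2 * Y).re + (star k ^ 2 * Y).im = T at *
  generalize Y.norm = M at *
  generalize k.norm = n at *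
  have hn2 : 0 < n ^ 2 := by positivity
  have hT2 : (4 * T) ^ 2 ≤ (14 * n ^ 2) ^ 2 := by
    apply pow_le_pow_left₀ (by linarith) hT
  have : n ^ 2 * M < n ^ 2 * (16 * n ^ 2) := by nlinarith
  exact lt_of_mul_lt_mul_left this hn2.le

/-! ### Descent -/

/-- `m` is the norm of an icosian. -/
def Ico (m : R5) : Prop := ∃ a b c d, Code a b c d ∧ a ^ 2 + b ^ 2 + c ^ 2 + d ^ 2 = 4 * m

lemma tp_of_code {k q : R5} (hq : TP q) {a b c d : R5} (hk : k ≠ 0)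
    (h : a ^ 2 + b ^ 2 + c ^ 2 + d ^ 2 = 4 * (q * k)) : TP k := by
  have h4 : (4 : R5) ≠ 0 := tp_four.ne
  have := sum_tp (a := a) (b := b) (c := c) (d := d)
    (by rw [h]; exact mul_ne_zero h4 (mul_ne_zero hq.ne hk))
  rw [h] at this
  exact TP.of_mul hq (TP.of_mul tp_four this)

lemma descent {q : R5} (hq : TP q) (hirr : Irreducible q) (n : ℕ) : ∀ k : R5, k ≠ 0 →
    k.norm.natAbs ≤ n → k.norm < q.norm → Ico (q * k) → Ico q := by
  induction n with
  | zero =>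
    intro k hk hn
    exact absurd (by omega) (norm_ne hk)
  | succ n ih =>
    rintro k hk hn hlt ⟨a, b, c, d, hC, hS⟩
    have hkp : TP k := tp_of_code hq hk hS
    have hkn := hkp.norm_pos
    by_cases h1 : k.norm = 1
    · obtain ⟨z, hz⟩ := unit_sq hkp h1
      have hz1 : z.norm ^ 2 = 1 := by rw [← map_pow, ← hz]; exact h1
      have hu : IsUnit z := by
        rw [isUnit_iff_norm_isUnit, Int.isUnit_iff]
        exact mul_self_eq_one_iff.1 (by rw [← pow_two]; exact hz1)
      obtain ⟨y, hy⟩ := hu.exists_left_inv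
      refine ⟨_, _, _, _, hC.smul y, ?_⟩
      have : y ^ 2 * z ^ 2 = 1 := by rw [← mul_pow, hy, one_pow]
      linear_combination y ^ 2 * hS + 4 * q * y ^ 2 * hz + 4 * q * this
    · obtain ⟨w0, w1, w2, w3, hW, hlt'⟩ := div_code a b c d k hk
      obtain ⟨nw, hnw⟩ := hW.norm
      obtain ⟨r₁, s₁, hw2, hw3⟩ := hW
      obtain ⟨r₂, s₂, hc, hd⟩ := hC
      obtain ⟨g0, g1, g2, g3⟩ := code_mul w0 w1 r₁ s₁ a b r₂ s₂ w2 w3 c d hw2 hw3 hc hd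
        _ _ _ _ rfl rfl rfl rfl
      have hG : Code (mulP ph w0 w1 r₁ s₁ a b r₂ s₂) (mulQ ph w0 w1 r₁ s₁ a b r₂ s₂)
        (mulP ph w0 w1 r₁ s₁ a b r₂ s₂ +
          ph * (mulQ ph w0 w1 r₁ s₁ a b r₂ s₂ - mulP ph w0 w1 r₁ s₁ a b r₂ s₂) +
          2 * mulR ph w0 w1 r₁ s₁ a b r₂ s₂)
        (mulQ ph w0 w1 r₁ s₁ a b r₂ s₂ +
          ph * (mulQ ph w0 w1 r₁ s₁ a b r₂ s₂ - mulP ph w0 w1 r₁ s₁ a b r₂ s₂) +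
          2 * mulS ph w0 w1 r₁ s₁ a b r₂ s₂) := ⟨_, _, rfl, rfl⟩
      generalize mulP ph w0 w1 r₁ s₁ a b r₂ s₂ +
          ph * (mulQ ph w0 w1 r₁ s₁ a b r₂ s₂ - mulP ph w0 w1 r₁ s₁ a b r₂ s₂) +
          2 * mulR ph w0 w1 r₁ s₁ a b r₂ s₂ = G2 at *
      generalize mulQ ph w0 w1 r₁ s₁ a b r₂ s₂ +
          ph * (mulQ ph w0 w1 r₁ s₁ a b r₂ s₂ - mulP ph w0 w1 r₁ s₁ a b r₂ s₂) +
          2 * mulS ph w0 w1 r₁ s₁ a b r₂ s₂ = G3 at *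
      generalize mulP ph w0 w1 r₁ s₁ a b r₂ s₂ = G0 at *
      generalize mulQ ph w0 w1 r₁ s₁ a b r₂ s₂ = G1 at *
      clear hw2 hw3 hc hd
      -- the remainder is divisible by four times k
      have hR : (a - k * w0) ^ 2 + (b - k * w1) ^ 2 + (c - k * w2) ^ 2 + (d - k * w3) ^ 2 =
          4 * (k * (q - G0 + k * nw)) := by
        linear_combination hS - 2 * k * g0 + k ^ 2 * hnw
      rw [hR] at hlt'
      have h4n : (4 : R5).norm = 16 := by
        rw [nrm]; rfl
      rw [map_mul, map_mul, h4n] at hlt'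
      by_cases hk' : q - G0 + k * nw = 0
      · rw [hk', mul_zero, mul_zero] at hR
        obtain ⟨z0, z1, z2, z3⟩ := sum_zero hR
        have hqk : q = k * nw := by
          apply mul_left_cancel₀ hk
          apply mul_left_cancel₀ tp_four.ne
          have ea : a = k * w0 := sub_eq_zero.1 z0
          have eb : b = k * w1 := sub_eq_zero.1 z1
          have ec : c = k * w2 := sub_eq_zero.1 z2
          have ed : d = k * w3 := sub_eq_zero.1 z3
          rw [ea, eb, ec, ed] at hS
          linear_combination -hS + k ^ 2 * hnw
        rcases hirr.isUnit_or_isUnit hqk with hu | hu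
        · rw [isUnit_iff_norm_isUnit, Int.isUnit_iff] at hu
          omega
        · rw [isUnit_iff_norm_isUnit, Int.isUnit_iff] at hu
          rw [hqk, map_mul] at hlt
          rcases hu with hu | hu <;> rw [hu] at hlt
          · omega
          · have := hq.norm_pos
            rw [hqk, map_mul, hu] at this
            omega
      · have hA : (2 * q - G0) ^ 2 + (- G1) ^ 2 + (- G2) ^ 2 + (- G3) ^ 2 =
            4 * (q * (q - G0 + k * nw)) := by
          have h4k : 4 * k ^ 2 ≠ 0 := mul_ne_zero tp_four.ne (pow_ne_zero 2 hk)
          apply mul_left_cancel₀ h4k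
          have i0 : (a - k * w0) * a + (b - k * w1) * b + (c - k * w2) * c + (d - k * w3) * d =
              2 * k * (2 * q - G0) := by linear_combination hS - k * g0
          have i1 : (a - k * w0) * b - (b - k * w1) * a - (c - k * w2) * d + (d - k * w3) * c =
              2 * k * (- G1) := by linear_combination - k * g1
          have i2 : (a - k * w0) * c + (b - k * w1) * d - (c - k * w2) * a - (d - k * w3) * b =
              2 * k * (- G2) := by linear_combination - k * g2
          have i3 : (a - k * w0) * d - (b - k * w1) * c + (c - k * w2) * b - (d - k * w3) * a =
              2 * k * (- G3) := by linear_combination - k * g3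
          have euler : ((a - k * w0) ^ 2 + (b - k * w1) ^ 2 + (c - k * w2) ^ 2 +
              (d - k * w3) ^ 2) * (a ^ 2 + b ^ 2 + c ^ 2 + d ^ 2) =
              (2 * k * (2 * q - G0)) ^ 2 + (2 * k * (- G1)) ^ 2 + (2 * k * (- G2)) ^ 2 +
              (2 * k * (- G3)) ^ 2 := by
            rw [← i0, ← i1, ← i2, ← i3]; ring
          rw [hR, hS] at euler
          linear_combination -euler
        have hkp' : TP (q - G0 + k * nw) := tp_of_code hq hk' hA
        have hlt2 : (q - G0 + k * nw).norm < k.norm := by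
          have : k.norm * (q - G0 + k * nw).norm < k.norm * k.norm := by nlinarith
          exact lt_of_mul_lt_mul_left this hkn.le
        have hp' := hkp'.norm_pos
        refine ih (q - G0 + k * nw) hk' (by omega) (by omega)
          ⟨2 * q - G0, - G1, - G2, - G3, ?_, hA⟩
        have := (code_two q 0 0 0).add (hG.smul (-1))
        convert this using 1 <;> ring

lemma ico_of_irr {q : R5} (hq : TP q) (hirr : Irreducible q) (h2 : ¬ q ∣ 2) : Ico q := by
  obtain ⟨x, y, k, hk⟩ := exists_xy hirr
  obtain ⟨w0, w1, w2, w3, hW, hlt⟩ := div_code (2 * 1) (2 * x) (2 * y) (2 * 0) q hq.ne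
  obtain ⟨nw, hnw⟩ := hW.norm
  have hR : (2 * 1 - q * w0) ^ 2 + (2 * x - q * w1) ^ 2 + (2 * y - q * w2) ^ 2 +
      (2 * 0 - q * w3) ^ 2 = 4 * (q * (k - (w0 + x * w1 + y * w2) + q * nw)) := by
    linear_combination 4 * hk + q ^ 2 * hnw
  by_cases hk' : k - (w0 + x * w1 + y * w2) + q * nw = 0
  · rw [hk', mul_zero, mul_zero] at hR
    obtain ⟨z0, -⟩ := sum_zero hR
    exact absurd ⟨w0, by linear_combination z0⟩ h2
  · have hkp := tp_of_code hq hk' hR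
    rw [hR] at hlt
    have h4n : (4 : R5).norm = 16 := by
      rw [nrm]; rfl
    rw [map_mul, map_mul, h4n] at hlt
    have hqn := hq.norm_pos
    refine descent hq hirr _ _ hk' le_rfl ?_ ⟨_, _, _, _, ?_, hR⟩
    · have : q.norm * (k - (w0 + x * w1 + y * w2) + q * nw).norm < q.norm * q.norm := by nlinarith
      exact lt_of_mul_lt_mul_left this hqn.le
    · have := (code_two 1 x y 0).add (hW.smul (-q))
      convert this using 1 <;> ring

/-! ### From icosians to Lipschitz quaternions -/

/-- Sum of four squares. -/
def Sum4 (m : R5) : Prop := ∃ a b c d : R5, m = a ^ 2 + b ^ 2 + c ^ 2 + d ^ 2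

/-- The residue field with four elements. -/
abbrev F4 := QuadraticAlgebra (ZMod 2) 1 1

/-- Reduction modulo two. -/
def red : R5 →+* F4 where
  toFun z := ⟨(z.re : ZMod 2), (z.im : ZMod 2)⟩
  map_one' := by ext <;> simp
  map_zero' := by ext <;> simp
  map_add' x y := by ext <;> simp
  map_mul' x y := by ext <;> simp

lemma red_zero {z : R5} (h : red z = 0) : ∃ y, z = 2 * y := by
  have h0 : ((z.re : ℤ) : ZMod 2) = 0 := congrArg QuadraticAlgebra.re h
  have h1 : ((z.im : ℤ) : ZMod 2) = 0 := congrArg QuadraticAlgebra.im h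
  rw [ZMod.intCast_zmod_eq_zero_iff_dvd] at h0 h1
  obtain ⟨x, hx⟩ := h0
  obtain ⟨y, hy⟩ := h1
  refine ⟨⟨x, y⟩, ?_⟩
  ext <;> simp [hx, hy]

lemma red_ph : red ph = ⟨0, 1⟩ := by
  ext <;> simp [red, ph]

lemma red_mulP (p₁ q₁ r₁ s₁ p₂ q₂ r₂ s₂ : R5) : red (mulP ph p₁ q₁ r₁ s₁ p₂ q₂ r₂ s₂) =
    mulP (red ph) (red p₁) (red q₁) (red r₁) (red s₁) (red p₂) (red q₂) (red r₂) (red s₂) := by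
  simp only [mulP, map_add, map_sub, map_neg, map_mul, map_one, map_ofNat]

lemma red_mulQ (p₁ q₁ r₁ s₁ p₂ q₂ r₂ s₂ : R5) : red (mulQ ph p₁ q₁ r₁ s₁ p₂ q₂ r₂ s₂) =
    mulQ (red ph) (red p₁) (red q₁) (red r₁) (red s₁) (red p₂) (red q₂) (red r₂) (red s₂) := by
  simp only [mulQ, map_add, map_sub, map_neg, map_mul, map_one, map_ofNat]

lemma red_nm (p q r s : R5) : red (nm ph p q r s) =
    nm (red ph) (red p) (red q) (red r) (red s) := by
  simp only [nm, map_add, map_sub, map_neg, map_mul, map_one]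

/-- The product of the conjugate of a unit and a given icosian has integral coordinates. -/
abbrev Good2 (p q r s : F4) (u v w t : F4) : Prop :=
  mulP ⟨0, 1⟩ u v w t p q r s = 0 ∧ mulQ ⟨0, 1⟩ u v w t p q r s = 0

/-- The field with four elements as an enumeration, for fast evaluation. -/
inductive Q4 where
  | z | o | a | b

/-- Fast addition. -/
def badd (x y : Q4) : Q4 :=
  match x with
  | .z => y
  | .o => match y with | .z => .o | .o => .z | .a => .b | .b => .a
  | .a => match y with | .z => .a | .o => .b | .a => .z | .b => .o
  | .b => match y with | .z => .b | .o => .a | .a => .o | .b => .z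

/-- Fast multiplication. -/
def bmul (x y : Q4) : Q4 :=
  match x with
  | .z => .z
  | .o => y
  | .a => match y with | .z => .z | .o => .a | .a => .b | .b => .o
  | .b => match y with | .z => .z | .o => .b | .a => .o | .b => .a

def bφ : Q4 := .a
def bψ : Q4 := .b

def toF : Q4 → F4
  | .z => ⟨0, 0⟩
  | .o => ⟨1, 0⟩
  | .a => ⟨0, 1⟩
  | .b => ⟨1, 1⟩

lemma toF_add (x y : Q4) : toF (badd x y) = toF x + toF y := by
  cases x <;> cases y <;> decide

lemma toF_mul (x y : Q4) : toF (bmul x y) = toF x * toF y := by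
  cases x <;> cases y <;> decide

lemma toF_surj (x : F4) : ∃ y, x = toF y := by
  have h : ∀ b c : ZMod 2, (⟨b, c⟩ : F4) = toF .z ∨ (⟨b, c⟩ : F4) = toF .o ∨
      (⟨b, c⟩ : F4) = toF .a ∨ (⟨b, c⟩ : F4) = toF .b := by decide
  rcases h x.re x.im with h | h | h | h <;> exact ⟨_, h⟩

lemma two_F4 : (2 : F4) = 0 := by decide

def bP (p₁ q₁ r₁ s₁ p₂ q₂ r₂ s₂ : Q4) : Q4 :=
  (badd (badd (badd (bmul p₁ (badd (badd (bmul bψ q₂) (bmul bψ r₂)) (bmul bφ s₂))) (bmul q₁ (badd (badd (bmul bψ p₂) (bmul bφ r₂)) (bmul bψ s₂)))) (bmul r₁ (badd (bmul bψ p₂) (bmul bφ q₂)))) (bmul s₁ (badd (bmul bφ p₂) (bmul bψ q₂))))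

def bQ (p₁ q₁ r₁ s₁ p₂ q₂ r₂ s₂ : Q4) : Q4 :=
  (badd (badd (badd (bmul p₁ (badd (bmul bφ r₂) (bmul bψ s₂))) (bmul q₁ (badd (bmul bψ r₂) (bmul bφ s₂)))) (bmul r₁ (badd (bmul bφ p₂) (bmul bψ q₂)))) (bmul s₁ (badd (bmul bψ p₂) (bmul bφ q₂))))

def bN (p q r s : Q4) : Q4 :=
  (badd (badd (badd (badd (badd (badd (badd (badd (bmul p p) (bmul bψ (bmul p q))) (bmul bψ (bmul p r))) (bmul bφ (bmul p s))) (bmul bψ (bmul q q))) (bmul bφ (bmul q r))) (bmul bψ (bmul q s))) (bmul r r)) (bmul s s))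

lemma toF_φ : toF bφ = ⟨0, 1⟩ := rfl
lemma toF_ψ : toF bψ = 1 + ⟨0, 1⟩ := rfl

lemma toF_P (p₁ q₁ r₁ s₁ p₂ q₂ r₂ s₂ : Q4) : toF (bP p₁ q₁ r₁ s₁ p₂ q₂ r₂ s₂) =
    mulP ⟨0, 1⟩ (toF p₁) (toF q₁) (toF r₁) (toF s₁) (toF p₂) (toF q₂) (toF r₂) (toF s₂) := by
  simp only [bP, mulP, toF_add, toF_mul, toF_φ, toF_ψ]
  generalize (⟨0, 1⟩ : F4) = φ
  have := two_F4
  grind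

lemma toF_Q (p₁ q₁ r₁ s₁ p₂ q₂ r₂ s₂ : Q4) : toF (bQ p₁ q₁ r₁ s₁ p₂ q₂ r₂ s₂) =
    mulQ ⟨0, 1⟩ (toF p₁) (toF q₁) (toF r₁) (toF s₁) (toF p₂) (toF q₂) (toF r₂) (toF s₂) := by
  simp only [bQ, mulQ, toF_add, toF_mul, toF_φ, toF_ψ]
  generalize (⟨0, 1⟩ : F4) = φ
  have := two_F4
  grind

lemma toF_N (p q r s : Q4) : toF (bN p q r s) =
    nm ⟨0, 1⟩ (toF p) (toF q) (toF r) (toF s) := by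
  simp only [bN, nm, toF_add, toF_mul, toF_φ, toF_ψ]
  generalize (⟨0, 1⟩ : F4) = φ
  have := two_F4
  grind

def isZ : Q4 → Bool
  | .z => true
  | .o => false
  | .a => false
  | .b => false

lemma toF_zero {x : Q4} : isZ x = true ↔ toF x = 0 := by
  cases x <;> decide

def bGood (p q r s u v w t : Q4) : Bool :=
  isZ (bP u v w t p q r s) && isZ (bQ u v w t p q r s)

lemma good_of_b {p q r s u v w t : Q4} (h : bGood p q r s u v w t = true) :
    Good2 (toF p) (toF q) (toF r) (toF s) (toF u) (toF v) (toF w) (toF t) := by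
  rw [bGood, Bool.and_eq_true, toF_zero, toF_zero, toF_P, toF_Q] at h
  exact h

def check (p q r s : Q4) : Bool :=
  isZ (bN p q r s) ||
  (bGood p q r s .a .z .o .a ||
    bGood p q r s .o .o .o .z ||
    bGood p q r s .o .z .z .z ||
    bGood p q r s .a .o .z .z ||
    bGood p q r s .o .z .z .a ||
    bGood p q r s .o .o .z .z ||
    bGood p q r s .z .b .z .z ||
    bGood p q r s .z .o .z .a ||
    bGood p q r s .a .z .o .o ||
    bGood p q r s .o .z .b .z ||
    bGood p q r s .a .z .z .a ||
    bGood p q r s .a .z .z .o ||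
    bGood p q r s .b .z .o .z ||
    bGood p q r s .z .z .z .o ||
    bGood p q r s .z .b .z .a)

/-- Exhaustive test. -/
def all4 (f : Q4 → Bool) : Bool := f .z && (f .o && (f .a && f .b))

lemma all4_spec {f : Q4 → Bool} (h : all4 f = true) (x : Q4) : f x = true := by
  simp only [all4, Bool.and_eq_true] at h
  obtain ⟨h0, h1, h2, h3⟩ := h
  cases x <;> assumption

lemma check_all : (all4 fun p => all4 fun q => all4 fun r => all4 fun s => check p q r s) = true := by
  decide +kernel

lemma finite_check (p q r s : F4) (hn : nm (⟨0, 1⟩ : F4) p q r s ≠ 0) :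
    Good2 p q r s (toF .a) (toF .z) (toF .o) (toF .a) ∨
    Good2 p q r s (toF .o) (toF .o) (toF .o) (toF .z) ∨
    Good2 p q r s (toF .o) (toF .z) (toF .z) (toF .z) ∨
    Good2 p q r s (toF .a) (toF .o) (toF .z) (toF .z) ∨
    Good2 p q r s (toF .o) (toF .z) (toF .z) (toF .a) ∨
    Good2 p q r s (toF .o) (toF .o) (toF .z) (toF .z) ∨
    Good2 p q r s (toF .z) (toF .b) (toF .z) (toF .z) ∨
    Good2 p q r s (toF .z) (toF .o) (toF .z) (toF .a) ∨
    Good2 p q r s (toF .a) (toF .z) (toF .o) (toF .o) ∨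
    Good2 p q r s (toF .o) (toF .z) (toF .b) (toF .z) ∨
    Good2 p q r s (toF .a) (toF .z) (toF .z) (toF .a) ∨
    Good2 p q r s (toF .a) (toF .z) (toF .z) (toF .o) ∨
    Good2 p q r s (toF .b) (toF .z) (toF .o) (toF .z) ∨
    Good2 p q r s (toF .z) (toF .z) (toF .z) (toF .o) ∨
    Good2 p q r s (toF .z) (toF .b) (toF .z) (toF .a) := by
  obtain ⟨p, rfl⟩ := toF_surj p
  obtain ⟨q, rfl⟩ := toF_surj q
  obtain ⟨r, rfl⟩ := toF_surj r
  obtain ⟨s, rfl⟩ := toF_surj s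
  rw [← toF_N, ne_eq, ← toF_zero] at hn
  have h := all4_spec (all4_spec (all4_spec (all4_spec check_all p) q) r) s
  rw [check, Bool.or_eq_true] at h
  replace h := h.resolve_left hn
  simp only [Bool.or_eq_true, or_assoc] at h
  exact h.imp good_of_b fun h => h.imp good_of_b fun h => h.imp good_of_b fun h => h.imp good_of_b fun h => h.imp good_of_b fun h => h.imp good_of_b fun h => h.imp good_of_b fun h => h.imp good_of_b fun h => h.imp good_of_b fun h => h.imp good_of_b fun h => h.imp good_of_b fun h => h.imp good_of_b fun h => h.imp good_of_b fun h => h.imp good_of_b fun h => good_of_b h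

lemma sum_of_unit {m p q r s : R5} (hS : m = nm ph p q r s)
    (u v w t : R5) (hu : nm ph u v w t = 1) {u' v' w' t' : F4}
    (h : Good2 (red p) (red q) (red r) (red s) u' v' w' t')
    (h0 : red u = u') (h1 : red v = v') (h2 : red w = w') (h3 : red t = t') :
    Sum4 m := by
  obtain ⟨hP, hQ⟩ := h
  rw [← red_ph, ← h0, ← h1, ← h2, ← h3] at hP hQ
  clear h0 h1 h2 h3
  rw [← red_mulP] at hP
  rw [← red_mulQ] at hQ
  obtain ⟨P, hP⟩ := red_zero hP
  obtain ⟨Q, hQ⟩ := red_zero hQ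
  have h1 := code_norm p q r s
  have h2 := code_norm u v w t
  obtain ⟨g0, g1, g2, g3⟩ := code_mul u v w t p q r s _ _ _ _ rfl rfl rfl rfl
    _ _ _ _ hP.symm hQ.symm rfl rfl
  generalize mulR ph u v w t p q r s = S2 at *
  generalize mulS ph u v w t p q r s = S3 at *
  rw [← hS] at h1
  rw [hu] at h2
  generalize p + ph * (q - p) + 2 * r = x2 at *
  generalize q + ph * (q - p) + 2 * s = x3 at *
  generalize u + ph * (v - u) + 2 * w = y2 at *
  generalize v + ph * (v - u) + 2 * t = y3 at *
  refine ⟨P, Q, P + ph * (Q - P) + S2, Q + ph * (Q - P) + S3, ?_⟩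
  have h16 : (4 : R5) * 4 ≠ 0 := mul_ne_zero tp_four.ne tp_four.ne
  apply mul_left_cancel₀ h16
  have euler : (u ^ 2 + v ^ 2 + y2 ^ 2 + y3 ^ 2) * (p ^ 2 + q ^ 2 + x2 ^ 2 + x3 ^ 2) =
      (u * p + v * q + y2 * x2 + y3 * x3) ^ 2 + (u * q - v * p - y2 * x3 + y3 * x2) ^ 2 +
      (u * x2 + v * x3 - y2 * p - y3 * q) ^ 2 + (u * x3 - v * x2 + y2 * q - y3 * p) ^ 2 := by
    ring
  rw [h1, h2, g0, g1, g2, g3] at euler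
  linear_combination euler

lemma sum4_of_ico {m : R5} (hm : ¬ (2 : R5) ∣ m) (h : Ico m) : Sum4 m := by
  obtain ⟨p, q, c, d, ⟨r, s, rfl, rfl⟩, hS⟩ := h
  rw [code_norm] at hS
  replace hS : m = nm ph p q r s := (mul_left_cancel₀ tp_four.ne hS).symm
  have hodd : nm (red ph) (red p) (red q) (red r) (red s) ≠ 0 := by
    rw [← red_nm, ← hS]
    intro h0
    obtain ⟨y, hy⟩ := red_zero h0
    exact hm ⟨y, hy⟩
  rw [red_ph] at hodd
  rcases finite_check _ _ _ _ hodd with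
    hh | hh | hh | hh | hh | hh | hh | hh | hh | hh | hh | hh | hh | hh | hh
  · exact sum_of_unit hS ⟨0, 1⟩ ⟨0, 0⟩ ⟨1, 0⟩ ⟨0, 1⟩ (by decide) hh rfl rfl rfl rfl
  · exact sum_of_unit hS ⟨-1, 0⟩ ⟨-1, 0⟩ ⟨1, 0⟩ ⟨0, 0⟩ (by decide) hh rfl rfl rfl rfl
  · exact sum_of_unit hS ⟨-1, 0⟩ ⟨0, 0⟩ ⟨0, 0⟩ ⟨0, 0⟩ (by decide) hh rfl rfl rfl rfl
  · exact sum_of_unit hS ⟨0, 1⟩ ⟨1, 0⟩ ⟨0, 0⟩ ⟨0, 0⟩ (by decide) hh rfl rfl rfl rfl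
  · exact sum_of_unit hS ⟨1, 0⟩ ⟨0, 0⟩ ⟨0, 0⟩ ⟨0, 1⟩ (by decide) hh rfl rfl rfl rfl
  · exact sum_of_unit hS ⟨1, 0⟩ ⟨1, 0⟩ ⟨0, 0⟩ ⟨0, 0⟩ (by decide) hh rfl rfl rfl rfl
  · exact sum_of_unit hS ⟨0, 0⟩ ⟨-1, 1⟩ ⟨0, 0⟩ ⟨0, 0⟩ (by decide) hh rfl rfl rfl rfl
  · exact sum_of_unit hS ⟨0, 0⟩ ⟨-1, 0⟩ ⟨0, 0⟩ ⟨0, 1⟩ (by decide) hh rfl rfl rfl rfl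
  · exact sum_of_unit hS ⟨0, 1⟩ ⟨0, 0⟩ ⟨1, 0⟩ ⟨1, 0⟩ (by decide) hh rfl rfl rfl rfl
  · exact sum_of_unit hS ⟨-1, 0⟩ ⟨0, 0⟩ ⟨1, -1⟩ ⟨0, 0⟩ (by decide) hh rfl rfl rfl rfl
  · exact sum_of_unit hS ⟨0, 1⟩ ⟨0, 0⟩ ⟨0, 0⟩ ⟨0, 1⟩ (by decide) hh rfl rfl rfl rfl
  · exact sum_of_unit hS ⟨0, 1⟩ ⟨0, 0⟩ ⟨0, 0⟩ ⟨1, 0⟩ (by decide) hh rfl rfl rfl rfl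
  · exact sum_of_unit hS ⟨1, -1⟩ ⟨0, 0⟩ ⟨-1, 0⟩ ⟨0, 0⟩ (by decide) hh rfl rfl rfl rfl
  · exact sum_of_unit hS ⟨0, 0⟩ ⟨0, 0⟩ ⟨0, 0⟩ ⟨-1, 0⟩ (by decide) hh rfl rfl rfl rfl
  · exact sum_of_unit hS ⟨0, 0⟩ ⟨1, -1⟩ ⟨0, 0⟩ ⟨0, 1⟩ (by decide) hh rfl rfl rfl rfl

/-! ### Conclusion -/

lemma Sum4.mul {x y : R5} (hx : Sum4 x) (hy : Sum4 y) : Sum4 (x * y) := by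
  obtain ⟨a, b, c, d, rfl⟩ := hx
  obtain ⟨a', b', c', d', rfl⟩ := hy
  exact ⟨a * a' + b * b' + c * c' + d * d', a * b' - b * a' - c * d' + d * c',
    a * c' + b * d' - c * a' - d * b', a * d' - b * c' + c * b' - d * a', by ring⟩

lemma sum4_sq (z : R5) : Sum4 (z ^ 2) := ⟨z, 0, 0, 0, by ring⟩

lemma even_case {m : R5} (hm : TP m) (h1 : m.norm ≠ 1) (h2 : m ∣ 2) : Sum4 m := by
  obtain ⟨z, hz⟩ := h2
  have hpos := hm.norm_pos
  have hN : m.norm * z.norm = 4 := by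
    rw [← map_mul, ← hz, nrm]; rfl
  have hz0 : 0 < z.norm := by nlinarith
  have key : ∀ x : R5, x.norm ≠ 2 := by
    intro x hx
    rw [nrm] at hx
    have h2 : (x.re * x.re + x.re * x.im - x.im * x.im) % 4 = 2 := by rw [hx]; rfl
    have h3 := Int.emod_nonneg x.re (by norm_num : (4 : ℤ) ≠ 0)
    have h4 := Int.emod_lt_of_pos x.re (by norm_num : (0 : ℤ) < 4)
    have h5 := Int.emod_nonneg x.im (by norm_num : (4 : ℤ) ≠ 0)
    have h6 := Int.emod_lt_of_pos x.im (by norm_num : (0 : ℤ) < 4)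
    rw [Int.sub_emod, Int.add_emod, Int.mul_emod, Int.mul_emod x.re x.im,
      Int.mul_emod x.im x.im] at h2
    generalize x.re % 4 = u at *
    generalize x.im % 4 = v at *
    interval_cases u <;> interval_cases v <;> simp at h2
  have hz1 : z.norm = 1 := by
    have h3 : z.norm ≤ 4 := by nlinarith
    have := key z
    generalize z.norm = b at *
    interval_cases b <;> omega
  have htz : TP z := by
    refine TP.of_mul hm ?_
    rw [← hz]
    constructor <;> (rw [map_ofNat]; norm_num)
  obtain ⟨e, he⟩ := unit_sq htz hz1
  have hzz : z * star z = 1 := by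
    have := star_mul_self' z
    rw [hz1] at this
    rw [mul_comm, this, Int.cast_one]
  refine ⟨star e, star e, 0, 0, ?_⟩
  have : star z = star e ^ 2 := by rw [he, star_pow]
  rw [← this]
  linear_combination (-star z) * hz - m * hzz

lemma sum4_irr {m : R5} (hm : TP m) (hirr : Irreducible m) : Sum4 m := by
  have h1 : m.norm ≠ 1 := by
    intro h
    apply hirr.not_isUnit
    rw [isUnit_iff_norm_isUnit, h]
    exact isUnit_one
  by_cases h2 : m ∣ 2
  · exact even_case hm h1 h2
  · refine sum4_of_ico ?_ (ico_of_irr hm hirr h2)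
    rintro ⟨y, hy⟩
    rcases hirr.isUnit_or_isUnit hy with hu | hu
    · rw [isUnit_iff_norm_isUnit, nrm, Int.isUnit_iff] at hu
      revert hu
      decide
    · obtain ⟨z, hz⟩ := hu.exists_right_inv
      exact h2 ⟨z, by rw [hy, mul_assoc, hz, mul_one]⟩

lemma norm_ph : ph.norm = -1 := by rw [nrm]; rfl

lemma sum4_all (n : ℕ) : ∀ m : R5, TP m → m.norm.natAbs ≤ n → Sum4 m := by
  induction n with
  | zero =>
    intro m hm hn
    have := hm.norm_pos
    omega
  | succ n ih =>
    intro m hm hn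
    have hpos := hm.norm_pos
    by_cases h1 : m.norm = 1
    · obtain ⟨z, rfl⟩ := unit_sq hm h1
      exact sum4_sq z
    by_cases hirr : Irreducible m
    · exact sum4_irr hm hirr
    have hnu : ¬ IsUnit m := by
      rw [isUnit_iff_norm_isUnit, Int.isUnit_iff]
      omega
    rw [irreducible_iff] at hirr
    push Not at hirr
    obtain ⟨x, y, hxy, hx, hy⟩ := hirr hnu
    rw [isUnit_iff_norm_isUnit, Int.isUnit_iff_natAbs_eq] at hx hy
    -- a factorisation into totally positive factors suffices
    have key : ∀ x y : R5, m = x * y → x.norm.natAbs ≠ 1 → y.norm.natAbs ≠ 1 → TP x → Sum4 m := by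
      intro x y hxy hx hy hxp
      have hyp : TP y := TP.of_mul hxp (hxy ▸ hm)
      have hxn := hxp.norm_pos
      have hyn := hyp.norm_pos
      have hN : m.norm = x.norm * y.norm := by rw [hxy, map_mul]
      have hx2 : 2 ≤ x.norm := by omega
      have hy2 : 2 ≤ y.norm := by omega
      have l1 : x.norm < m.norm := by nlinarith
      have l2 : y.norm < m.norm := by nlinarith
      rw [hxy]
      exact (ih x hxp (by omega)).mul (ih y hyp (by omega))
    have hx0 : x.norm ≠ 0 := by
      intro h
      rw [hxy, map_mul, h, zero_mul] at hpos
      exact lt_irrefl _ hpos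
    have key2 : ∀ x y : R5, m = x * y → x.norm.natAbs ≠ 1 → y.norm.natAbs ≠ 1 →
        0 < x.norm → Sum4 m := by
      intro x y hxy hx hy hxp
      rcases tp_or hxp with h | h
      · exact key x y hxy hx hy h
      · exact key (-x) (-y) (by rw [hxy]; ring) (by rwa [QuadraticAlgebra.norm_neg])
          (by rwa [QuadraticAlgebra.norm_neg]) h
    rcases lt_or_gt_of_ne hx0 with h | h
    · refine key2 (ph * x) ((ph - 1) * y) ?_ ?_ ?_ ?_
      · linear_combination hxy - x * y * ph_sq
      · rw [map_mul, norm_ph]; simpa using hx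
      · have : (ph - 1).norm = -1 := by rw [nrm]; rfl
        rw [map_mul, this]; simpa using hy
      · rw [map_mul, norm_ph]; linarith
    · exact key2 x y hxy hx hy h

end Gold

/-- every totally positive element of `ℤ[(1+√5)/2]` is a sum of
four squares of elements of `ℤ[(1+√5)/2]`.  Elements are encoded as pairs
`(a,b) ↔ a + b·(1+√5)/2`, determined by their two real embeddings, so an
equation in `O_K` is expressed as equalities under both embeddings. -/
theorem four_squares_universal_sqrt5 (m : ℤ × ℤ)
    (hm₁ : 0 < goldEmb (Real.sqrt 5) m) (hm₂ : 0 < goldEmb (-Real.sqrt 5) m) :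
    ∃ x : Fin 4 → ℤ × ℤ,
      goldEmb (Real.sqrt 5) m = ∑ i, (goldEmb (Real.sqrt 5) (x i)) ^ 2 ∧
      goldEmb (-Real.sqrt 5) m = ∑ i, (goldEmb (-Real.sqrt 5) (x i)) ^ 2 := by
  have hTP : Gold.TP ⟨m.1, m.2⟩ := ⟨hm₁, hm₂⟩
  obtain ⟨a, b, c, d, h⟩ := Gold.sum4_all _ _ hTP le_rfl
  refine ⟨![(a.re, a.im), (b.re, b.im), (c.re, c.im), (d.re, d.im)], ?_, ?_⟩
  · have h1 := congrArg Gold.e₁ h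
    simp only [map_add, map_pow, Gold.e₁_def] at h1
    simpa [Fin.sum_univ_four, goldEmb] using h1
  · have h2 := congrArg Gold.e₂ h
    simp only [map_add, map_pow, Gold.e₂_def] at h2
    simpa [Fin.sum_univ_four, goldEmb] using h2
end

section
/- Among all real quadratic fields K, the quaternary quadratic form x₁² + x₂² + x₃² + x₄² is universal over O_K if and only if K = ℚ(√5). -/
open NumberField

namespace FourSq
open QuadraticAlgebra

/-- `ℤ[ω]`, `ω² = 1 + ω`. -/
abbrev O := QuadraticAlgebra ℤ 1 1
/-- `ℚ(√5)`. -/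
abbrev F := QuadraticAlgebra ℚ 1 1

instance factF : Fact (∀ r : ℚ, r ^ 2 ≠ 1 + 1 * r) := ⟨by
  intro r h
  have h1 : (2 * r - 1) ^ 2 = 5 := by linear_combination 4 * h
  have h2 : IsSquare (5 : ℚ) := ⟨2 * r - 1, by rw [← h1]; ring⟩
  have h3 : IsSquare ((5 : ℕ) : ℚ) := by exact_mod_cast h2
  rw [Rat.isSquare_natCast_iff] at h3
  obtain ⟨k, hk⟩ := h3
  have : k < 3 := by nlinarith
  interval_cases k <;> omega⟩

theorem F_norm (x : F) : QuadraticAlgebra.norm x = x.re ^ 2 + x.re * x.im - x.im ^ 2 := by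
  rw [norm_def]; ring

theorem O_norm (x : O) : QuadraticAlgebra.norm x = x.re ^ 2 + x.re * x.im - x.im ^ 2 := by
  rw [norm_def]; ring

/-- inclusion -/
def io : O →+* F where
  toFun x := ⟨x.re, x.im⟩
  map_one' := by ext <;> simp
  map_zero' := by ext <;> simp
  map_add' x y := by ext <;> simp
  map_mul' x y := by ext <;> simp

@[simp] theorem io_re (x : O) : (io x).re = x.re := rfl
@[simp] theorem io_im (x : O) : (io x).im = x.im := rfl

theorem io_inj : Function.Injective io := by
  intro x y h
  have h1 := congrArg QuadraticAlgebra.re h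
  have h2 := congrArg QuadraticAlgebra.im h
  simp at h1 h2
  ext <;> assumption

theorem io_norm (x : O) : QuadraticAlgebra.norm (io x) = (QuadraticAlgebra.norm x : ℤ) := by
  rw [F_norm, O_norm]; simp

instance : IsDomain O := io_inj.isDomain io

/-- embedding given by a root of `x² = x + 1`. -/
noncomputable def em (g : ℝ) (hg : g ^ 2 = g + 1) : F →+* ℝ where
  toFun x := x.re + x.im * g
  map_one' := by simp
  map_zero' := by simp
  map_add' x y := by simp; ring
  map_mul' x y := by simp; linear_combination (-(x.im : ℝ) * y.im) * hg

noncomputable def e1 : F →+* ℝ := em Real.goldenRatio Real.goldenRatio_sq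
noncomputable def e2 : F →+* ℝ := em Real.goldenConj Real.goldenConj_sq

theorem e1_def (x : F) : e1 x = x.re + x.im * Real.goldenRatio := rfl
theorem e2_def (x : F) : e2 x = x.re + x.im * Real.goldenConj := rfl

theorem e_norm (x : F) : ((QuadraticAlgebra.norm x : ℚ) : ℝ) = e1 x * e2 x := by
  rw [F_norm, e1_def, e2_def]
  have h1 := Real.goldenRatio_add_goldenConj
  have h2 := Real.goldenRatio_mul_goldenConj
  push_cast
  linear_combination (-(x.re : ℝ) * x.im) * h1 - (x.im : ℝ) ^ 2 * h2

/-- total positivity -/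
def TP (x : F) : Prop := 0 < e1 x ∧ 0 < e2 x

theorem TP.mul {x y : F} (hx : TP x) (hy : TP y) : TP (x * y) := by
  refine ⟨?_, ?_⟩ <;> rw [map_mul]
  · exact mul_pos hx.1 hy.1
  · exact mul_pos hx.2 hy.2

theorem TP.of_mul {x y : F} (hx : TP x) (hy : TP (x * y)) : TP y := by
  have h1 := hy.1
  have h2 := hy.2
  rw [map_mul] at h1 h2
  exact ⟨(pos_iff_pos_of_mul_pos h1).1 hx.1, (pos_iff_pos_of_mul_pos h2).1 hx.2⟩

theorem TP.norm_pos {x : O} (hx : TP (io x)) : 0 < QuadraticAlgebra.norm x := by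
  have h := mul_pos hx.1 hx.2
  rw [← e_norm, io_norm] at h
  exact_mod_cast h

theorem e1_star (x : F) : e1 (star x) = e2 x := by
  rw [e1_def, e2_def, ← Real.one_sub_goldenRatio]; simp; ring

theorem e2_star (x : F) : e2 (star x) = e1 x := by
  rw [e1_def, e2_def, ← Real.one_sub_goldenConj]; simp; ring

theorem io_star (x : O) : io (star x) = star (io x) := by
  ext <;> simp

theorem isUnit_iff (x : O) : IsUnit x ↔ QuadraticAlgebra.norm x = 1 ∨ QuadraticAlgebra.norm x = -1 := by
  rw [isUnit_iff_norm_isUnit, Int.isUnit_iff]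

theorem unit_sq_aux : ∀ n : ℕ, ∀ s t : ℤ, t.natAbs = n → 0 ≤ t → s ^ 2 + s * t - t ^ 2 = 1 → 0 < s →
    ∃ y : O, (⟨s, t⟩ : O) = y ^ 2 ∧ IsUnit y := by
  intro n
  induction n using Nat.strong_induction_on with
  | _ n ih =>
    intro s t hn ht h hs
    rcases ht.eq_or_lt with h0 | h0
    · subst h0
      have : s = 1 := by nlinarith
      subst this
      exact ⟨1, by ext <;> simp, isUnit_one⟩
    · have hst : s ≤ t := by
        by_contra hh
        push Not at hh
        nlinarith
      obtain ⟨y, hy, hu⟩ := ih (t - s).natAbs (by omega) (2 * s - t) (t - s) rfl (by omega)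
        (by linear_combination h) (by nlinarith)
      refine ⟨y * ⟨0, 1⟩, ?_, hu.mul ?_⟩
      · rw [mul_pow, ← hy]
        ext <;> simp [pow_two] <;> ring
      · rw [isUnit_iff, O_norm]; simp

theorem unit_sq {x : O} (hu : IsUnit x) (hx : TP (io x)) : ∃ y : O, x = y ^ 2 ∧ IsUnit y := by
  have hn : QuadraticAlgebra.norm x = 1 := by
    rcases (isUnit_iff x).1 hu with h | h
    · exact h
    · have := hx.norm_pos
      omega
  have key : ∀ z : O, QuadraticAlgebra.norm z = 1 → TP (io z) → 0 ≤ z.im →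
      ∃ y : O, z = y ^ 2 ∧ IsUnit y := by
    intro z hz hp him
    rw [O_norm] at hz
    refine unit_sq_aux _ z.re z.im rfl him hz ?_
    have h2 := hp.2
    rw [e2_def] at h2
    simp at h2
    have h3 := Real.goldenConj_neg
    have h4 : (0 : ℝ) ≤ z.im := by exact_mod_cast him
    have : (0 : ℝ) < z.re := by nlinarith
    exact_mod_cast this
  rcases le_total 0 x.im with h | h
  · exact key x hn hx h
  · obtain ⟨y, hy, hyu⟩ := key (star x) (by rw [QuadraticAlgebra.norm_star, hn])
      (by rw [io_star]; exact ⟨by rw [e1_star]; exact hx.2, by rw [e2_star]; exact hx.1⟩)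
      (by simp; exact h)
    refine ⟨star y, ?_, hyu.star⟩
    rw [← star_star x, hy, star_pow]

theorem exists_unit_TP {x : O} (hx : x ≠ 0) : ∃ u : O, IsUnit u ∧ TP (io (u * x)) := by
  have hF : io x ≠ 0 := by rwa [Ne, map_eq_zero_iff io io_inj]
  have h1 : e1 (io x) ≠ 0 := by simpa using hF
  have h2 : e2 (io x) ≠ 0 := by simpa using hF
  have g1 := Real.goldenRatio_pos
  have g2 := Real.goldenConj_neg
  have w1 : e1 (io ⟨0, 1⟩) = Real.goldenRatio := by rw [e1_def]; simp
  have w2 : e2 (io ⟨0, 1⟩) = Real.goldenConj := by rw [e2_def]; simp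
  have wu : IsUnit (⟨0, 1⟩ : O) := by rw [isUnit_iff, O_norm]; simp
  rcases lt_or_gt_of_ne h1 with a | a <;> rcases lt_or_gt_of_ne h2 with b | b
  · refine ⟨-1, isUnit_one.neg, ?_, ?_⟩ <;> simp [a, b]
  · refine ⟨-⟨0, 1⟩, wu.neg, ?_, ?_⟩
    · rw [map_mul, map_mul, map_neg, map_neg, w1]; nlinarith
    · rw [map_mul, map_mul, map_neg, map_neg, w2]; nlinarith
  · refine ⟨⟨0, 1⟩, wu, ?_, ?_⟩
    · rw [map_mul, map_mul, w1]; nlinarith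
    · rw [map_mul, map_mul, w2]; nlinarith
  · exact ⟨1, isUnit_one, by simpa using a, by simpa using b⟩

theorem F_div (x : F) : ∃ q : O, |QuadraticAlgebra.norm (x - io q)| < 1 := by
  refine ⟨⟨round x.re, round x.im⟩, ?_⟩
  have h1 := abs_le.1 (abs_sub_round x.re)
  have h2 := abs_le.1 (abs_sub_round x.im)
  rw [F_norm]
  simp only [re_sub, im_sub, io_re, io_im]
  generalize x.re - (round x.re : ℤ) = s at *
  generalize x.im - (round x.im : ℤ) = t at *
  rw [abs_lt]
  constructor <;> nlinarith

theorem O_div (x y : O) (hy : y ≠ 0) :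
    ∃ q : O, |QuadraticAlgebra.norm (x - q * y)| < |QuadraticAlgebra.norm y| := by
  have hF : io y ≠ 0 := by rwa [Ne, map_eq_zero_iff io io_inj]
  obtain ⟨q, hq⟩ := F_div (io x / io y)
  refine ⟨q, ?_⟩
  have h1 : io (x - q * y) = (io x / io y - io q) * io y := by
    rw [sub_mul, div_mul_cancel₀ _ hF]; simp
  have h2 := io_norm (x - q * y)
  rw [h1, map_mul, io_norm] at h2
  have h3 : (0 : ℚ) < |((QuadraticAlgebra.norm y : ℤ) : ℚ)| := by
    rw [← io_norm, abs_pos, Ne, norm_eq_zero_iff_eq_zero]; exact hF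
  have h4 := mul_lt_mul_of_pos_right hq h3
  rw [← abs_mul, h2, one_mul] at h4
  exact_mod_cast h4

theorem O_norm_eq_zero {x : O} : QuadraticAlgebra.norm x = 0 ↔ x = 0 := by
  rw [← map_eq_zero_iff io io_inj, ← norm_eq_zero_iff_eq_zero, io_norm]; simp

instance O_pir : IsPrincipalIdealRing O := by
  constructor
  intro I
  by_cases hI : I = ⊥
  · subst hI; infer_instance
  obtain ⟨x, hx, hx0⟩ := Submodule.exists_mem_ne_zero_of_ne_bot hI
  classical
  have hex : ∃ n : ℕ, ∃ y ∈ I, y ≠ 0 ∧ (QuadraticAlgebra.norm y).natAbs = n := ⟨_, x, hx, hx0, rfl⟩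
  obtain ⟨y, hy, hy0, hyn⟩ := Nat.find_spec hex
  refine ⟨y, le_antisymm ?_ ?_⟩
  · intro z hz
    obtain ⟨q, hq⟩ := O_div z y hy0
    have hm : z - q * y ∈ I := I.sub_mem hz (I.mul_mem_left q hy)
    by_cases h0 : z - q * y = 0
    · rw [sub_eq_zero.1 h0]
      exact Submodule.mem_span_singleton.2 ⟨q, rfl⟩
    · exfalso
      have := Nat.find_min' hex ⟨_, hm, h0, rfl⟩
      rw [← hyn] at this
      rw [Int.abs_eq_natAbs, Int.abs_eq_natAbs] at hq
      omega
  · exact (Submodule.span_singleton_le_iff_mem _ _).2 hy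

theorem exists_two_sq {p : O} (hp : Irreducible p) : ∃ a b r : O, 1 + a ^ 2 + b ^ 2 = p * r := by
  have hmax : (Ideal.span {p}).IsMaximal := PrincipalIdealRing.isMaximal_of_irreducible hp
  let : Field (O ⧸ Ideal.span {p}) := Ideal.Quotient.field _
  have : Finite (O ⧸ Ideal.span {p}) := Ideal.finiteQuotientOfFreeOfNeBot _ (by
    rw [Ne, Ideal.span_singleton_eq_bot]; exact hp.ne_zero)
  have := Fintype.ofFinite (O ⧸ Ideal.span {p})
  have key : ∃ a b : O ⧸ Ideal.span {p}, 1 + a ^ 2 + b ^ 2 = 0 := by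
    by_cases hc : ringChar (O ⧸ Ideal.span {p}) = 2
    · have : CharP (O ⧸ Ideal.span {p}) 2 := ringChar.of_eq hc
      exact ⟨1, 0, by simpa [one_add_one_eq_two] using CharTwo.two_eq_zero⟩
    · open Polynomial in
      obtain ⟨a, b, h⟩ := FiniteField.exists_root_sum_quadratic (R := O ⧸ Ideal.span {p})
        (f := X ^ 2) (g := X ^ 2 - C (-1)) (degree_X_pow 2)
        (degree_X_pow_sub_C (by decide) _) (FiniteField.odd_card_of_char_ne_two hc)
      refine ⟨a, b, ?_⟩
      simp at h
      linear_combination h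
  obtain ⟨a, b, h⟩ := key
  obtain ⟨a, rfl⟩ := Ideal.Quotient.mk_surjective a
  obtain ⟨b, rfl⟩ := Ideal.Quotient.mk_surjective b
  have h2 : Ideal.Quotient.mk (Ideal.span {p}) (1 + a ^ 2 + b ^ 2) = 0 := by
    rw [← h]; simp
  rw [Ideal.Quotient.eq_zero_iff_mem, Ideal.mem_span_singleton] at h2
  obtain ⟨r, hr⟩ := h2
  exact ⟨a, b, r, hr⟩

end FourSq

namespace FourSq
open QuadraticAlgebra
open scoped Quaternion

/-- the element `ω` of `O` -/
def W : O := ⟨0, 1⟩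

theorem W_sq : W ^ 2 = W + 1 := by
  ext <;> simp [W, pow_two]

theorem ioW_sq : io W ^ 2 = io W + 1 := by
  rw [← map_pow, W_sq]; simp

/-- icosian with `O`-coordinates `a b c d`. -/
def Qn (a b c d : O) : ℍ[F] :=
  ⟨io a + io c / 2, io b + (io c + io d) / 2, (io c + (io W - 1) * io d) / 2,
    (io c + io W * io d) / 2⟩

theorem Qn_re (a b c d : O) : (Qn a b c d).re = io a + io c / 2 := rfl
theorem Qn_imI (a b c d : O) : (Qn a b c d).imI = io b + (io c + io d) / 2 := rfl
theorem Qn_imJ (a b c d : O) : (Qn a b c d).imJ = (io c + (io W - 1) * io d) / 2 := rfl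
theorem Qn_imK (a b c d : O) : (Qn a b c d).imK = (io c + io W * io d) / 2 := rfl

theorem Qn_add (a b c d p q r s : O) :
    Qn a b c d + Qn p q r s = Qn (a + p) (b + q) (c + r) (d + s) := by
  apply Quaternion.ext <;> simp [Qn_re, Qn_imI, Qn_imJ, Qn_imK] <;> ring

theorem Qn_neg (a b c d : O) : -Qn a b c d = Qn (-a) (-b) (-c) (-d) := by
  apply Quaternion.ext <;> simp [Qn_re, Qn_imI, Qn_imJ, Qn_imK] <;> ring

theorem Qn_coe (a : O) : Qn a 0 0 0 = ((io a : F) : ℍ[F]) := by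
  apply Quaternion.ext <;> simp [Qn_re, Qn_imI, Qn_imJ, Qn_imK]

theorem Qn_star (a b c d : O) : star (Qn a b c d) = Qn (a + c) (-b) (-c) (-d) := by
  apply Quaternion.ext <;> simp [Qn_re, Qn_imI, Qn_imJ, Qn_imK] <;> ring

theorem Qn_mul (a b c d p q r s : O) :
    Qn a b c d * Qn p q r s = Qn
      (a*p - b*q - b*r + b*s - c*r + c*s - 2*d*q - d*r - d*s + W*(b*r - c*q - c*s))
      (a*q + b*p - b*r + 2*b*s + 2*c*q + 2*c*s - 2*d*q - 2*d*r
        + W*(b*r - b*s - c*q - c*s + d*q + d*r))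
      (a*r + b*r - 3*b*s + c*p - c*q + c*r - 2*c*s + 3*d*q + 2*d*r
        + W*(-2*b*r + 2*c*q + c*s - d*r))
      (a*s + 2*b*r - b*s - 2*c*q - c*s + d*p + d*q + 2*d*r
        + W*(2*b*s + c*s - 2*d*q - d*r)) := by
  have h := ioW_sq
  apply Quaternion.ext <;> simp only [Qn_re, Qn_imI, Qn_imJ, Qn_imK, Quaternion.re_mul, Quaternion.imI_mul, Quaternion.imJ_mul,
    Quaternion.imK_mul, map_add, map_sub, map_mul, map_neg, map_ofNat]
  all_goals generalize io W = w at *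
  all_goals generalize io a = a at *
  all_goals generalize io b = b at *
  all_goals generalize io c = c at *
  all_goals generalize io d = d at *
  all_goals generalize io p = p at *
  all_goals generalize io q = q at *
  all_goals generalize io r = r at *
  all_goals generalize io s = s at *
  all_goals grind

/-- the reduced norm in coordinates -/
def nn (a b c d : O) : O := a^2 + b^2 + c^2 + d^2 + a*c + b*c + b*d + W*c*d

theorem Qn_normSq (a b c d : O) : Quaternion.normSq (Qn a b c d) = io (nn a b c d) := by
  have h := ioW_sq
  rw [Quaternion.normSq_def']
  simp only [Qn_re, Qn_imI, Qn_imJ, Qn_imK, nn, map_add, map_mul, map_pow]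
  linear_combination (io d ^ 2 / 2) * h

/-- The icosian ring. -/
def Ic : Subring ℍ[F] where
  carrier := {x | ∃ a b c d : O, x = Qn a b c d}
  mul_mem' := by
    rintro _ _ ⟨a, b, c, d, rfl⟩ ⟨p, q, r, s, rfl⟩
    exact ⟨_, _, _, _, Qn_mul ..⟩
  add_mem' := by
    rintro _ _ ⟨a, b, c, d, rfl⟩ ⟨p, q, r, s, rfl⟩
    exact ⟨_, _, _, _, Qn_add ..⟩
  neg_mem' := by
    rintro _ ⟨a, b, c, d, rfl⟩
    exact ⟨_, _, _, _, Qn_neg ..⟩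
  one_mem' := ⟨1, 0, 0, 0, by rw [Qn_coe]; simp⟩
  zero_mem' := ⟨0, 0, 0, 0, by rw [Qn_coe]; simp⟩

theorem mem_Ic {x : ℍ[F]} : x ∈ Ic ↔ ∃ a b c d : O, x = Qn a b c d := Iff.rfl

theorem star_mem_Ic {x : ℍ[F]} (hx : x ∈ Ic) : star x ∈ Ic := by
  obtain ⟨a, b, c, d, rfl⟩ := hx
  exact ⟨_, _, _, _, Qn_star ..⟩

theorem coe_mem_Ic (a : O) : ((io a : F) : ℍ[F]) ∈ Ic := ⟨a, 0, 0, 0, (Qn_coe a).symm⟩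

theorem decode (y0 y1 y2 y3 y4 y5 y6 y7 : ℚ) : ∃ x0 x1 x2 x3 x4 x5 x6 x7 : ℤ,
    (x0 + x5 + x6 + x7) % 2 = 0 ∧ (x1 + x4 + x5 + x6) % 2 = 0 ∧ (x2 + x4 + x5 + x7) % 2 = 0 ∧
    (x3 + x4 + x6 + x7) % 2 = 0 ∧
    (y0 - x0)^2 + (y1 - x1)^2 + (y2 - x2)^2 + (y3 - x3)^2 + (y4 - x4)^2 + (y5 - x5)^2
      + (y6 - x6)^2 + (y7 - x7)^2 ≤ 7 / 2 := by
  have key : ∀ y : ℚ, ∃ n m : ℤ, (n + m) % 2 = 1 ∧ (y - n) ^ 2 ≤ 1 / 4 ∧ (y - m) ^ 2 ≤ 1 := by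
    intro y
    have h := abs_le.1 (abs_sub_round y)
    rcases le_total (0 : ℚ) (y - (round y : ℤ)) with h0 | h0
    · refine ⟨round y, round y + 1, by omega, ?_, ?_⟩
      · nlinarith
      · push_cast; nlinarith
    · refine ⟨round y, round y - 1, by omega, ?_, ?_⟩
      · nlinarith
      · push_cast; nlinarith
  obtain ⟨n0, m0, p0, a0, b0⟩ := key y0
  obtain ⟨n1, m1, p1, a1, b1⟩ := key y1
  obtain ⟨n2, m2, p2, a2, b2⟩ := key y2
  obtain ⟨n3, m3, p3, a3, b3⟩ := key y3
  obtain ⟨n4, m4, p4, a4, b4⟩ := key y4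
  obtain ⟨n5, m5, p5, a5, b5⟩ := key y5
  obtain ⟨n6, m6, p6, a6, b6⟩ := key y6
  obtain ⟨n7, m7, p7, a7, b7⟩ := key y7
  rcases Int.emod_two_eq (n0 + n5 + n6 + n7) with s1 | s1 <;>
  rcases Int.emod_two_eq (n1 + n4 + n5 + n6) with s2 | s2 <;>
  rcases Int.emod_two_eq (n2 + n4 + n5 + n7) with s3 | s3 <;>
  rcases Int.emod_two_eq (n3 + n4 + n6 + n7) with s4 | s4
  · exact ⟨n0, n1, n2, n3, n4, n5, n6, n7, by omega, by omega, by omega, by omega, by linarith⟩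
  · exact ⟨n0, n1, n2, m3, n4, n5, n6, n7, by omega, by omega, by omega, by omega, by linarith⟩
  · exact ⟨n0, n1, m2, n3, n4, n5, n6, n7, by omega, by omega, by omega, by omega, by linarith⟩
  · exact ⟨n0, n1, m2, m3, n4, n5, n6, n7, by omega, by omega, by omega, by omega, by linarith⟩
  · exact ⟨n0, m1, n2, n3, n4, n5, n6, n7, by omega, by omega, by omega, by omega, by linarith⟩
  · exact ⟨n0, m1, n2, m3, n4, n5, n6, n7, by omega, by omega, by omega, by omega, by linarith⟩
  · exact ⟨n0, m1, m2, n3, n4, n5, n6, n7, by omega, by omega, by omega, by omega, by linarith⟩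
  · exact ⟨n0, n1, n2, n3, m4, n5, n6, n7, by omega, by omega, by omega, by omega, by linarith⟩
  · exact ⟨m0, n1, n2, n3, n4, n5, n6, n7, by omega, by omega, by omega, by omega, by linarith⟩
  · exact ⟨m0, n1, n2, m3, n4, n5, n6, n7, by omega, by omega, by omega, by omega, by linarith⟩
  · exact ⟨m0, n1, m2, n3, n4, n5, n6, n7, by omega, by omega, by omega, by omega, by linarith⟩
  · exact ⟨n0, n1, n2, n3, n4, n5, n6, m7, by omega, by omega, by omega, by omega, by linarith⟩
  · exact ⟨m0, m1, n2, n3, n4, n5, n6, n7, by omega, by omega, by omega, by omega, by linarith⟩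
  · exact ⟨n0, n1, n2, n3, n4, n5, m6, n7, by omega, by omega, by omega, by omega, by linarith⟩
  · exact ⟨n0, n1, n2, n3, n4, m5, n6, n7, by omega, by omega, by omega, by omega, by linarith⟩
  · exact ⟨m0, n1, n2, n3, m4, n5, n6, n7, by omega, by omega, by omega, by omega, by linarith⟩

theorem two_re (x : F) : (x / 2).re = x.re / 2 ∧ (x / 2).im = x.im / 2 := by
  have h : (x / 2) * 2 = x := by field_simp
  generalize x / 2 = y at *
  have h1 := congrArg QuadraticAlgebra.re h
  have h2 := congrArg QuadraticAlgebra.im h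
  simp at h1 h2
  constructor <;> linarith

theorem approx_aux (x : ℍ[F]) (x0 x1 x2 x3 x4 x5 x6 x7 k1 k2 k3 k4 : ℤ)
  (q1 : (x0 : ℚ) - (x5 + x6 - x7) = 2 * k1)
  (q2 : (x1 : ℚ) - (x5 - x6 + x4) = 2 * k2)
  (q3 : (x2 : ℚ) - (x5 + 2 * x6 - x7 - x4) = 2 * k3)
  (q4 : (x3 : ℚ) - (x4 - x6 + x7) = 2 * k4) :
  (Quaternion.normSq (x - Qn ⟨k1, k2⟩ ⟨k3, k4⟩ ⟨x5 + x6 - x7, x5 - x6 + x4⟩ ⟨x6 - x4, x7 - x5⟩)).re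
    = ((2 * x.re.re - x0)^2 + (2 * x.re.im - x1)^2 + (2 * x.imI.re - x2)^2 +
      (2 * x.imI.im - x3)^2 + (2 * x.imJ.re - x4)^2 + (2 * x.imJ.im - x5)^2
    + (2 * x.imK.re - x6)^2 + (2 * x.imK.im - x7)^2) / 4 := by
  have r0 : (x0 : ℚ) = (x5 + x6 - x7) + 2 * k1 := by linarith
  have r1 : (x1 : ℚ) = (x5 - x6 + x4) + 2 * k2 := by linarith
  have r2 : (x2 : ℚ) = (x5 + 2 * x6 - x7 - x4) + 2 * k3 := by linarith
  have r3 : (x3 : ℚ) = (x4 - x6 + x7) + 2 * k4 := by linarith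
  rw [Quaternion.normSq_def', r0, r1, r2, r3]
  simp only [pow_two, re_add, re_mul, Quaternion.re_sub, Quaternion.imI_sub, Quaternion.imJ_sub,
    Quaternion.imK_sub, Qn_re, Qn_imI, Qn_imJ, Qn_imK, re_sub, im_sub, two_re, im_add, im_mul,
    io_re, io_im, W, re_one, im_one]
  push_cast
  ring

theorem Ic_approx (x : ℍ[F]) : ∃ l ∈ Ic,
    QuadraticAlgebra.norm (Quaternion.normSq (x - l)) < 1 := by
  obtain ⟨x0, x1, x2, x3, x4, x5, x6, x7, h1, h2, h3, h4, h⟩ :=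
    decode (2 * x.re.re) (2 * x.re.im) (2 * x.imI.re) (2 * x.imI.im) (2 * x.imJ.re) (2 * x.imJ.im)
      (2 * x.imK.re) (2 * x.imK.im)
  obtain ⟨k1, hk1⟩ : ∃ k, x0 - (x5 + x6 - x7) = 2 * k := ⟨(x0 - (x5 + x6 - x7)) / 2, by omega⟩
  obtain ⟨k2, hk2⟩ : ∃ k, x1 - (x5 - x6 + x4) = 2 * k := ⟨(x1 - (x5 - x6 + x4)) / 2, by omega⟩
  obtain ⟨k3, hk3⟩ : ∃ k, x2 - (x5 + 2 * x6 - x7 - x4) = 2 * k :=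
    ⟨(x2 - (x5 + 2 * x6 - x7 - x4)) / 2, by omega⟩
  obtain ⟨k4, hk4⟩ : ∃ k, x3 - (x4 - x6 + x7) = 2 * k := ⟨(x3 - (x4 - x6 + x7)) / 2, by omega⟩
  refine ⟨Qn ⟨k1, k2⟩ ⟨k3, k4⟩ ⟨x5 + x6 - x7, x5 - x6 + x4⟩ ⟨x6 - x4, x7 - x5⟩,
    ⟨_, _, _, _, rfl⟩, ?_⟩
  have q1 : (x0 : ℚ) - (x5 + x6 - x7) = 2 * k1 := by exact_mod_cast hk1
  have q2 : (x1 : ℚ) - (x5 - x6 + x4) = 2 * k2 := by exact_mod_cast hk2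
  have q3 : (x2 : ℚ) - (x5 + 2 * x6 - x7 - x4) = 2 * k3 := by exact_mod_cast hk3
  have q4 : (x3 : ℚ) - (x4 - x6 + x7) = 2 * k4 := by exact_mod_cast hk4
  have hre : ∀ z : F, QuadraticAlgebra.norm z ≤ 5 / 4 * z.re ^ 2 := by
    intro z
    rw [F_norm]
    nlinarith [sq_nonneg (z.im - z.re / 2)]
  refine (hre _).trans_lt ?_
  rw [approx_aux x x0 x1 x2 x3 x4 x5 x6 x7 k1 k2 k3 k4 q1 q2 q3 q4]
  have h0 : 0 ≤ (2 * x.re.re - x0)^2 + (2 * x.re.im - x1)^2 + (2 * x.imI.re - x2)^2 +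
        (2 * x.imI.im - x3)^2 + (2 * x.imJ.re - x4)^2 + (2 * x.imJ.im - x5)^2
      + (2 * x.imK.re - x6)^2 + (2 * x.imK.im - x7)^2 := by positivity
  revert h h0
  generalize (2 * x.re.re - x0)^2 + (2 * x.re.im - x1)^2 + (2 * x.imI.re - x2)^2 +
        (2 * x.imI.im - x3)^2 + (2 * x.imJ.re - x4)^2 + (2 * x.imJ.im - x5)^2
      + (2 * x.imK.re - x6)^2 + (2 * x.imK.im - x7)^2 = A
  intro h h0
  nlinarith

theorem normSq_nonneg1 (x : ℍ[F]) : 0 ≤ e1 (Quaternion.normSq x) := by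
  rw [Quaternion.normSq_def']; simp only [map_add, map_pow]; positivity

theorem normSq_nonneg2 (x : ℍ[F]) : 0 ≤ e2 (Quaternion.normSq x) := by
  rw [Quaternion.normSq_def']; simp only [map_add, map_pow]; positivity

theorem normSq_zero {x : ℍ[F]} (h : Quaternion.normSq x = 0) : x = 0 := by
  have h1 : e1 (Quaternion.normSq x) = 0 := by rw [h, map_zero]
  rw [Quaternion.normSq_def'] at h1
  simp only [map_add, map_pow] at h1
  have hz : ∀ z : F, e1 z = 0 → z = 0 := fun z hz => by simpa using hz
  apply Quaternion.ext <;> apply hz <;> apply pow_eq_zero_iff (two_ne_zero) |>.1 <;> nlinarith [sq_nonneg (e1 x.re), sq_nonneg (e1 x.imI),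
    sq_nonneg (e1 x.imJ), sq_nonneg (e1 x.imK)]

theorem norm_normSq_nonneg (x : ℍ[F]) : 0 ≤ QuadraticAlgebra.norm (Quaternion.normSq x) := by
  have := mul_nonneg (normSq_nonneg1 x) (normSq_nonneg2 x)
  rw [← e_norm] at this
  exact_mod_cast this

theorem Ic_div (x y : ℍ[F]) (hy : y ≠ 0) : ∃ l ∈ Ic,
    QuadraticAlgebra.norm (Quaternion.normSq (x - l * y)) <
      QuadraticAlgebra.norm (Quaternion.normSq y) := by
  have hn : Quaternion.normSq y ≠ 0 := fun h => hy (normSq_zero h)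
  obtain ⟨l, hl, h⟩ := Ic_approx (x * (star y * (((Quaternion.normSq y)⁻¹ : F) : ℍ[F])))
  refine ⟨l, hl, ?_⟩
  have e : x - l * y = (x * (star y * (((Quaternion.normSq y)⁻¹ : F) : ℍ[F])) - l) * y := by
    have : star y * (((Quaternion.normSq y)⁻¹ : F) : ℍ[F]) * y = 1 := by
      rw [mul_assoc, Quaternion.coe_commutes, ← mul_assoc, Quaternion.star_mul_self,
        ← Quaternion.coe_mul, mul_inv_cancel₀ hn, Quaternion.coe_one]
    rw [sub_mul, mul_assoc x, this, mul_one]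
  rw [e, map_mul, map_mul]
  have hp : 0 < QuadraticAlgebra.norm (Quaternion.normSq y) := by
    refine lt_of_le_of_ne (norm_normSq_nonneg y) (Ne.symm ?_)
    rwa [Ne, norm_eq_zero_iff_eq_zero]
  nlinarith

theorem Ic_principal (J : Set ℍ[F]) (hJ : ∀ x ∈ J, x ∈ Ic)
    (hadd : ∀ x ∈ J, ∀ y ∈ J, ∀ l ∈ Ic, x - l * y ∈ J) (hne : ∃ x ∈ J, x ≠ 0) :
    ∃ g ∈ J, ∀ x ∈ J, ∃ l ∈ Ic, x = l * g := by
  classical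
  obtain ⟨x0, hx0, hx1⟩ := hne
  have hN : ∀ x ∈ J, ∃ n : ℕ, QuadraticAlgebra.norm (Quaternion.normSq x) = n := by
    intro x hx
    obtain ⟨a, b, c, d, rfl⟩ := hJ x hx
    have h := norm_normSq_nonneg (Qn a b c d)
    rw [Qn_normSq, io_norm] at h ⊢
    have h' : 0 ≤ QuadraticAlgebra.norm (nn a b c d) := by exact_mod_cast h
    exact ⟨(QuadraticAlgebra.norm (nn a b c d)).toNat, by
      rw [← Int.cast_natCast, Int.toNat_of_nonneg h']⟩
  have hex : ∃ n : ℕ, ∃ y ∈ J, y ≠ 0 ∧ QuadraticAlgebra.norm (Quaternion.normSq y) = n := by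
    obtain ⟨n, hn⟩ := hN x0 hx0
    exact ⟨n, x0, hx0, hx1, hn⟩
  obtain ⟨y, hy, hy0, hyn⟩ := Nat.find_spec hex
  refine ⟨y, hy, fun z hz => ?_⟩
  obtain ⟨l, hl, h⟩ := Ic_div z y hy0
  refine ⟨l, hl, ?_⟩
  by_contra h0
  have hm := hadd z hz y hy l hl
  obtain ⟨n, hn⟩ := hN _ hm
  have := Nat.find_min' hex ⟨_, hm, sub_ne_zero.2 h0, hn⟩
  rw [hn, hyn] at h
  have : n < Nat.find hex := by exact_mod_cast h
  omega

end FourSq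

namespace FourSq
open QuadraticAlgebra
open scoped Quaternion

/-- third coordinate of the product of two icosians -/
def c3 (a b c d p q r s : O) : O :=
  a*r + b*r - 3*b*s + c*p - c*q + c*r - 2*c*s + 3*d*q + 2*d*r + W*(-2*b*r + 2*c*q + c*s - d*r)

/-- fourth coordinate of the product of two icosians -/
def c4 (a b c d p q r s : O) : O :=
  a*s + 2*b*r - b*s - 2*c*q - c*s + d*p + d*q + 2*d*r + W*(2*b*s + c*s - 2*d*q - d*r)

/-- reduced norm with products only -/
def nn2 (a b c d : O) : O := a*a + b*b + c*c + d*d + a*c + b*c + b*d + W*c*d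

/-- divisibility by two -/
def ev (z : O) : Bool := z.re % 2 == 0 && z.im % 2 == 0

theorem ev_iff (z : O) : ev z = true ↔ 2 ∣ z := by
  simp only [ev, Bool.and_eq_true, beq_iff_eq]
  constructor
  · rintro ⟨h1, h2⟩
    exact ⟨⟨z.re / 2, z.im / 2⟩, by ext <;> simp <;> omega⟩
  · rintro ⟨y, rfl⟩
    simp

/-- representatives modulo two -/
def reps : List O := [⟨0, 0⟩, ⟨1, 0⟩, ⟨0, 1⟩, ⟨1, 1⟩]

/-- enough icosian units -/
def us : List (O × O × O × O) :=
  [(⟨0, 0⟩, ⟨0, 0⟩, ⟨0, 0⟩, ⟨1, 0⟩), (⟨0, 0⟩, ⟨0, 0⟩, ⟨1, 0⟩, ⟨0, 0⟩),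
   (⟨1, 0⟩, ⟨0, 0⟩, ⟨0, 0⟩, ⟨0, 0⟩), (⟨0, 0⟩, ⟨1, 0⟩, ⟨0, 0⟩, ⟨-1, 0⟩),
   (⟨0, 0⟩, ⟨0, 0⟩, ⟨1, 0⟩, ⟨0, -1⟩), (⟨0, 0⟩, ⟨0, 0⟩, ⟨0, -1⟩, ⟨0, 1⟩),
   (⟨0, 0⟩, ⟨-1, 0⟩, ⟨1, 0⟩, ⟨0, 0⟩), (⟨1, 0⟩, ⟨0, 0⟩, ⟨-1, 0⟩, ⟨0, 1⟩),
   (⟨0, -1⟩, ⟨0, 0⟩, ⟨0, 1⟩, ⟨-1, 0⟩), (⟨0, 0⟩, ⟨-1, 1⟩, ⟨1, 0⟩, ⟨0, -1⟩),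
   (⟨0, 0⟩, ⟨-1, 0⟩, ⟨1, 0⟩, ⟨1, -1⟩), (⟨0, 0⟩, ⟨1, -1⟩, ⟨0, 1⟩, ⟨-1, 0⟩),
   (⟨0, 0⟩, ⟨-1, 1⟩, ⟨1, 0⟩, ⟨1, -1⟩), (⟨1, 0⟩, ⟨1, 0⟩, ⟨-1, 0⟩, ⟨-1, 1⟩),
   (⟨1, 0⟩, ⟨1, -1⟩, ⟨-1, 0⟩, ⟨-1, 1⟩)]

theorem us_norm : ∀ u ∈ us, nn2 u.1 u.2.1 u.2.2.1 u.2.2.2 = 1 := by decide +kernel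

theorem fin_check : ∀ p ∈ reps, ∀ q ∈ reps, ∀ r ∈ reps, ∀ s ∈ reps, ev (nn2 p q r s) = true ∨
    ∃ u ∈ us, ev (c3 u.1 u.2.1 u.2.2.1 u.2.2.2 p q r s) = true ∧
      ev (c4 u.1 u.2.1 u.2.2.1 u.2.2.2 p q r s) = true := by decide +kernel

theorem exists_rep (z : O) : ∃ p ∈ reps, ∃ y, z = p + 2 * y := by
  refine ⟨⟨z.re % 2, z.im % 2⟩, ?_, ⟨z.re / 2, z.im / 2⟩, ?_⟩
  · rcases Int.emod_two_eq z.re with h | h <;> rcases Int.emod_two_eq z.im with h' | h' <;>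
      rw [h, h'] <;> simp [reps]
  · ext <;> simp <;> omega

theorem nn_eq (a b c d : O) : nn a b c d = nn2 a b c d := by
  simp only [nn, nn2]; ring

theorem nn_mul (a b c d p q r s : O) : ∃ x y, nn x y (c3 a b c d p q r s) (c4 a b c d p q r s) =
    nn a b c d * nn p q r s := by
  have h := congrArg Quaternion.normSq (Qn_mul a b c d p q r s)
  rw [map_mul, Qn_normSq, Qn_normSq, Qn_normSq, ← map_mul] at h
  exact ⟨_, _, (io_inj h).symm⟩

theorem nn_four_sq {a b c d : O} (h : ¬ (2 : O) ∣ nn a b c d) :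
    ∃ x y z w : O, nn a b c d = x ^ 2 + y ^ 2 + z ^ 2 + w ^ 2 := by
  obtain ⟨p, hp, p', rfl⟩ := exists_rep a
  obtain ⟨q, hq, q', rfl⟩ := exists_rep b
  obtain ⟨r, hr, r', rfl⟩ := exists_rep c
  obtain ⟨s, hs, s', rfl⟩ := exists_rep d
  rcases fin_check p hp q hq r hr s hs with h0 | ⟨u, hu, h3, h4⟩
  · exfalso
    apply h
    rw [ev_iff] at h0
    have e : nn (p + 2 * p') (q + 2 * q') (r + 2 * r') (s + 2 * s') = nn2 p q r s + 2 *
        (2 * (p * p' + q * q' + r * r' + s * s') + p * r' + p' * r + q * r' + q' * r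
          + q * s' + q' * s + W * r * s' + W * r' * s + 2 * nn p' q' r' s') := by
      simp only [nn, nn2]; ring
    rw [e]
    exact dvd_add h0 (dvd_mul_right _ _)
  · rw [ev_iff] at h3 h4
    obtain ⟨u1, u2, u3, u4⟩ := u
    have hn := us_norm _ hu
    simp only at h3 h4 hn
    obtain ⟨X, Y, hXY⟩ := nn_mul u1 u2 u3 u4 (p + 2 * p') (q + 2 * q') (r + 2 * r') (s + 2 * s')
    rw [nn_eq u1, hn, one_mul] at hXY
    have f3 : c3 u1 u2 u3 u4 (p + 2 * p') (q + 2 * q') (r + 2 * r') (s + 2 * s')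
        = c3 u1 u2 u3 u4 p q r s + 2 * c3 u1 u2 u3 u4 p' q' r' s' := by simp only [c3]; ring
    have f4 : c4 u1 u2 u3 u4 (p + 2 * p') (q + 2 * q') (r + 2 * r') (s + 2 * s')
        = c4 u1 u2 u3 u4 p q r s + 2 * c4 u1 u2 u3 u4 p' q' r' s' := by simp only [c4]; ring
    obtain ⟨C, hC⟩ : 2 ∣ c3 u1 u2 u3 u4 (p + 2 * p') (q + 2 * q') (r + 2 * r') (s + 2 * s') := by
      rw [f3]; exact dvd_add h3 (dvd_mul_right _ _)
    obtain ⟨D, hD⟩ : 2 ∣ c4 u1 u2 u3 u4 (p + 2 * p') (q + 2 * q') (r + 2 * r') (s + 2 * s') := by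
      rw [f4]; exact dvd_add h4 (dvd_mul_right _ _)
    rw [hC, hD] at hXY
    refine ⟨X + C, Y + C + D, C + (W - 1) * D, C + W * D, ?_⟩
    rw [← hXY]
    simp only [nn]
    linear_combination (-2 * D ^ 2) * W_sq

theorem left_inv {x : ℍ[F]} (hx : x ∈ Ic) {n : O} (hn : Quaternion.normSq x = io n)
    (hu : IsUnit n) : ∃ l ∈ Ic, l * x = 1 := by
  obtain ⟨v, hv⟩ := hu.exists_left_inv
  refine ⟨((io v : F) : ℍ[F]) * star x, Ic.mul_mem (coe_mem_Ic v) (star_mem_Ic hx), ?_⟩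
  rw [mul_assoc, Quaternion.star_mul_self, hn, ← Quaternion.coe_mul, ← map_mul, hv]
  simp

theorem not_mul_P {p : O} (hp2 : ¬ p ∣ 2) {x : ℍ[F]} (hx : x.re = 1) {y : ℍ[F]} (hy : y ∈ Ic) :
    x ≠ y * ((io p : F) : ℍ[F]) := by
  rintro rfl
  obtain ⟨a, b, c, d, rfl⟩ := hy
  simp [Qn_re] at hx
  apply hp2
  refine ⟨2 * a + c, io_inj ?_⟩
  simp only [map_mul, map_add, map_ofNat]
  linear_combination (-2) * hx

theorem not_dvd_two {p : O} (hp : Irreducible p) (h2 : ¬ (2 : O) ∣ p) : ¬ p ∣ 2 := by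
  rintro ⟨q, hq⟩
  have h := congrArg QuadraticAlgebra.norm hq
  rw [map_mul] at h
  have h4 : QuadraticAlgebra.norm (2 : O) = 4 := by rw [O_norm]; simp
  rw [h4] at h
  have hodd : (QuadraticAlgebra.norm p) % 2 = 1 := by
    rw [← ev_iff] at h2
    simp only [ev, Bool.and_eq_true, beq_iff_eq] at h2
    rw [O_norm]
    rcases Int.emod_two_eq p.re with h | h <;> rcases Int.emod_two_eq p.im with h' | h' <;>
      simp [h, h'] at h2 <;> simp [pow_two, Int.sub_emod, Int.add_emod, Int.mul_emod, h, h']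
  have hu : QuadraticAlgebra.norm p ∣ 1 := by
    have hc : IsCoprime (QuadraticAlgebra.norm p) (4 : ℤ) := by
      rw [Int.isCoprime_iff_gcd_eq_one]
      have : IsCoprime (QuadraticAlgebra.norm p) (2 : ℤ) :=
        ⟨1, -(QuadraticAlgebra.norm p / 2), by omega⟩
      have := this.mul_right this
      rw [Int.isCoprime_iff_gcd_eq_one] at this
      exact this
    have : QuadraticAlgebra.norm p ∣ 4 * 1 := ⟨_, by rw [← h]; rfl⟩
    exact hc.dvd_of_dvd_mul_left this
  apply hp.not_isUnit
  rw [isUnit_iff_norm_isUnit]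
  exact isUnit_of_dvd_one hu

/-- sums of four squares -/
def S4 (m : O) : Prop := ∃ x y z w : O, m = x ^ 2 + y ^ 2 + z ^ 2 + w ^ 2

theorem S4.mul_sq {m : O} (h : S4 m) (t : O) : S4 (m * t ^ 2) := by
  obtain ⟨x, y, z, w, rfl⟩ := h
  exact ⟨x * t, y * t, z * t, w * t, by ring⟩

theorem S4.mul {m n : O} (h : S4 m) (h' : S4 n) : S4 (m * n) := by
  obtain ⟨x, y, z, w, rfl⟩ := h
  obtain ⟨a, b, c, d, rfl⟩ := h'
  exact ⟨_, _, _, _, (euler_four_squares x y z w a b c d).symm⟩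

theorem prime_S4 {p : O} (hp : Irreducible p) (hT : TP (io p)) (h2 : ¬ (2 : O) ∣ p) : S4 p := by
  have hp2 := not_dvd_two hp h2
  obtain ⟨a, b, r, hab⟩ := exists_two_sq hp
  have hp0 : io p ≠ 0 := by rw [Ne, map_eq_zero_iff io io_inj]; exact hp.ne_zero
  obtain ⟨x0, hx0⟩ : ∃ x, x = Qn (1 - W * b) (a - W * b + b) (2 * (W * b)) (-(2 * b)) := ⟨_, rfl⟩
  have hx0I : x0 ∈ Ic := ⟨_, _, _, _, hx0⟩
  have hx0re : x0.re = 1 := by rw [hx0, Qn_re]; simp only [map_sub, map_one, map_mul, map_ofNat]; ring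
  have hx0n : Quaternion.normSq x0 = io (p * r) := by
    rw [hx0, Qn_normSq, ← hab]
    congr 1
    simp only [nn]
    linear_combination (-2 * b ^ 2) * W_sq
  obtain ⟨P, hP⟩ : ∃ P : ℍ[F], P = ((io p : F) : ℍ[F]) := ⟨_, rfl⟩
  have hPI : P ∈ Ic := hP ▸ coe_mem_Ic p
  have hPn : Quaternion.normSq P = io (p ^ 2) := by rw [hP, Quaternion.normSq_coe, map_pow]
  obtain ⟨g, ⟨b1, hb1, c1, hc1, hg⟩, hgen⟩ := Ic_principal
    {x | ∃ b ∈ Ic, ∃ c ∈ Ic, x = b * P + c * x0}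
    (by
      rintro _ ⟨b, hb, c, hc, rfl⟩
      exact Ic.add_mem (Ic.mul_mem hb hPI) (Ic.mul_mem hc hx0I))
    (by
      rintro _ ⟨b, hb, c, hc, rfl⟩ _ ⟨b', hb', c', hc', rfl⟩ l hl
      exact ⟨b - l * b', Ic.sub_mem hb (Ic.mul_mem hl hb'), c - l * c',
        Ic.sub_mem hc (Ic.mul_mem hl hc'), by simp only [sub_mul, mul_add, mul_assoc]; abel⟩)
    ⟨P, ⟨1, Ic.one_mem, 0, Ic.zero_mem, by simp⟩, by
      intro h
      rw [h, map_zero] at hPn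
      rw [map_pow] at hPn
      exact pow_ne_zero 2 hp0 hPn.symm⟩
  obtain ⟨β, hβ, hPβ⟩ := hgen P ⟨1, Ic.one_mem, 0, Ic.zero_mem, by simp⟩
  obtain ⟨γ, hγ, hxγ⟩ := hgen x0 ⟨0, Ic.zero_mem, 1, Ic.one_mem, by simp⟩
  have hgI : g ∈ Ic := by
    rw [hg]; exact Ic.add_mem (Ic.mul_mem hb1 hPI) (Ic.mul_mem hc1 hx0I)
  obtain ⟨nb, hnb⟩ : ∃ n, Quaternion.normSq β = io n := by
    obtain ⟨_, _, _, _, rfl⟩ := hβ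
    exact ⟨_, Qn_normSq ..⟩
  obtain ⟨g1, g2, g3, g4, hgQ⟩ := hgI
  have hng : Quaternion.normSq g = io (nn g1 g2 g3 g4) := by rw [hgQ, Qn_normSq]
  have hgI : g ∈ Ic := ⟨_, _, _, _, hgQ⟩
  have hprod : nb * nn g1 g2 g3 g4 = p ^ 2 := by
    apply io_inj
    rw [map_mul, ← hnb, ← hng, ← map_mul, ← hPβ, hPn]
  have hdvd : nn g1 g2 g3 g4 ∣ p ^ 2 := ⟨nb, by rw [← hprod]; ring⟩
  obtain ⟨i, hi, hass⟩ := (dvd_prime_pow hp.prime 2).1 hdvd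
  interval_cases i
  · exfalso
    rw [pow_zero, associated_one_iff_isUnit] at hass
    obtain ⟨l, hl, hl1⟩ := left_inv hgI hng hass
    refine not_mul_P hp2 (x := star x0) (by rw [Quaternion.re_star, hx0re])
      (y := l * b1 * star x0 + l * c1 * ((io r : F) : ℍ[F])) ?_ ?_
    · exact Ic.add_mem (Ic.mul_mem (Ic.mul_mem hl hb1) (star_mem_Ic hx0I))
        (Ic.mul_mem (Ic.mul_mem hl hc1) (coe_mem_Ic r))
    · have e1 : x0 * star x0 = ((io r : F) : ℍ[F]) * P := by
        rw [Quaternion.self_mul_star, hx0n, hP, ← Quaternion.coe_mul, ← map_mul, mul_comm p]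
      have e2 : P * star x0 = star x0 * P := by rw [hP]; exact Quaternion.coe_commutes ..
      calc star x0 = (l * g) * star x0 := by rw [hl1, one_mul]
        _ = l * b1 * (P * star x0) + l * c1 * (x0 * star x0) := by rw [hg]; noncomm_ring
        _ = _ := by rw [e1, e2, ← hP]; noncomm_ring
  · rw [pow_one] at hass
    obtain ⟨v, hv⟩ := hass
    have hTg : TP (io (nn g1 g2 g3 g4)) := by
      have h0 : io (nn g1 g2 g3 g4) ≠ 0 := by
        intro h
        rw [← hv, map_mul, h, zero_mul] at hp0
        exact hp0 rfl
      rw [← hng] at h0 ⊢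
      exact ⟨lt_of_le_of_ne (normSq_nonneg1 g) (Ne.symm (by simpa using h0)),
        lt_of_le_of_ne (normSq_nonneg2 g) (Ne.symm (by simpa using h0))⟩
    have hTv : TP (io v) := by
      refine hTg.of_mul ?_
      rw [← map_mul, hv]; exact hT
    obtain ⟨y, hy, -⟩ := unit_sq v.isUnit hTv
    have hS : S4 (nn g1 g2 g3 g4) := by
      apply nn_four_sq
      intro h
      apply h2
      rw [← hv]
      exact h.mul_right _
    rw [← hv, hy]
    exact hS.mul_sq y
  · exfalso
    have hub : IsUnit nb := by
      obtain ⟨v, hv⟩ := hass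
      have h0 : p ^ 2 ≠ 0 := pow_ne_zero 2 hp.ne_zero
      refine IsUnit.of_mul_eq_one (nn g1 g2 g3 g4 * 0 + ((v⁻¹ : Oˣ) : O)) ?_
      have h3 : nn g1 g2 g3 g4 = p ^ 2 * ((v⁻¹ : Oˣ) : O) := by
        rw [← hv, mul_assoc, Units.mul_inv, mul_one]
      rw [h3] at hprod ⊢
      apply mul_left_cancel₀ h0
      linear_combination hprod
    obtain ⟨l, hl, hl1⟩ := left_inv hβ hnb hub
    refine not_mul_P hp2 hx0re (y := γ * l) (Ic.mul_mem hγ hl) ?_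
    rw [← hP, mul_assoc, hPβ, ← mul_assoc l, hl1, one_mul, ← hxγ]

theorem universal_O : ∀ n : ℕ, ∀ m : O, (QuadraticAlgebra.norm m).natAbs = n → TP (io m) → S4 m := by
  intro n
  induction n using Nat.strong_induction_on with
  | _ n ih =>
    intro m hn hT
    by_cases hu : IsUnit m
    · obtain ⟨y, hy, -⟩ := unit_sq hu hT
      exact ⟨y, 0, 0, 0, by rw [hy]; ring⟩
    by_cases hi : Irreducible m
    · by_cases h2 : (2 : O) ∣ m
      · obtain ⟨v, rfl⟩ := h2
        have h2u : ¬ IsUnit (2 : O) := by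
          rw [isUnit_iff, O_norm]; simp
        have hv : IsUnit v := (hi.isUnit_or_isUnit rfl).resolve_left h2u
        have hTv : TP (io v) := by
          refine TP.of_mul (x := io 2) ?_ (by rw [← map_mul]; exact hT)
          exact ⟨by rw [map_ofNat io, map_ofNat e1]; norm_num,
            by rw [map_ofNat io, map_ofNat e2]; norm_num⟩
        obtain ⟨y, hy, -⟩ := unit_sq hv hTv
        exact ⟨y, y, 0, 0, by rw [hy]; ring⟩
      · exact prime_S4 hi hT h2
    · rw [irreducible_iff] at hi
      push Not at hi
      obtain ⟨a, b, rfl, ha, hb⟩ := hi hu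
      have hpos := hT.norm_pos
      have hab0 : a * b ≠ 0 := by
        intro h; rw [h] at hpos; simp at hpos
      obtain ⟨u, huu, huT⟩ := exists_unit_TP (left_ne_zero_of_mul hab0)
      obtain ⟨v, hv⟩ := huu.exists_right_inv
      have e : a * b = (u * a) * (v * b) := by linear_combination (-(a * b)) * hv
      have hvT : TP (io (v * b)) := by
        refine huT.of_mul ?_
        rw [← map_mul, ← e]; exact hT
      have hvu : IsUnit v := IsUnit.of_mul_eq_one u (by rw [mul_comm]; exact hv)
      have hgt : ∀ z : O, ¬ IsUnit z → TP (io z) → 1 < (QuadraticAlgebra.norm z).natAbs := by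
        intro z hz hzT
        have := hzT.norm_pos
        have h1 : QuadraticAlgebra.norm z ≠ 1 := fun h => hz ((isUnit_iff z).2 (Or.inl h))
        omega
      have h1 := hgt (u * a) (by rw [huu.mul_left_iff]; exact ha) huT
      have h2 := hgt (v * b) (by rw [hvu.mul_left_iff]; exact hb) hvT
      have hn' : (QuadraticAlgebra.norm (u * a)).natAbs * (QuadraticAlgebra.norm (v * b)).natAbs = n := by
        rw [← Int.natAbs_mul, ← map_mul, ← e, hn]
      rw [e]
      exact (ih _ (by nlinarith) _ rfl huT).mul (ih _ (by nlinarith) _ rfl hvT)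

end FourSq

namespace FourSq
open QuadraticAlgebra

theorem sqf_rat {d : ℤ} (hd : Squarefree d) (q : ℚ) (k : ℤ) (h : d * q ^ 2 = k) :
    ∃ n : ℤ, q = n := by
  have hq0 : (q.den : ℚ) ≠ 0 := by exact_mod_cast q.den_nz
  have h1 : d * q.num ^ 2 = k * (q.den : ℤ) ^ 2 := by
    have : (d : ℚ) * q.num ^ 2 = k * (q.den : ℚ) ^ 2 := by
      rw [← h]
      nth_rewrite 2 [← Rat.num_div_den q]
      field_simp
    exact_mod_cast this
  have hc : IsCoprime ((q.den : ℤ) ^ 2) (q.num ^ 2) := by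
    have : IsCoprime q.num (q.den : ℤ) := by
      rw [Int.isCoprime_iff_gcd_eq_one]
      exact q.reduced
    exact this.symm.pow
  have h2 : (q.den : ℤ) * q.den ∣ d := by
    rw [← sq]
    exact hc.dvd_of_dvd_mul_right (Dvd.intro_left k h1.symm)
  have h3 := hd _ h2
  have h4 : q.den = 1 := by
    have := Int.isUnit_iff.1 h3
    omega
  exact ⟨q.num, (Rat.coe_int_num_of_den_eq_one h4).symm⟩

theorem int_of_rat (q : ℚ) (h : IsIntegral ℤ q) : ∃ n : ℤ, q = n := by
  obtain ⟨n, hn⟩ := IsIntegrallyClosed.isIntegral_iff.1 h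
  exact ⟨n, by simpa using hn.symm⟩

theorem tr_norm_int {a b : ℚ} (z : QuadraticAlgebra ℚ a b)
    (hz : IsIntegral ℤ z) :
    (∃ t : ℤ, 2 * z.re + b * z.im = t) ∧ ∃ n : ℤ, QuadraticAlgebra.norm z = n := by
  have hs : IsIntegral ℤ (star z) := map_isIntegral_int (starRingEnd (QuadraticAlgebra ℚ a b)) hz
  have hinj : Function.Injective (algebraMap ℚ (QuadraticAlgebra ℚ a b)) :=
    QuadraticAlgebra.algebraMap_injective
  have key : ∀ q : ℚ, IsIntegral ℤ (algebraMap ℚ (QuadraticAlgebra ℚ a b) q) → ∃ n : ℤ, q = n := by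
    intro q hq
    apply int_of_rat
    obtain ⟨p, hp, he⟩ := hq
    refine ⟨p, hp, hinj ?_⟩
    rw [map_zero, Polynomial.hom_eval₂, ← he]
    congr 1
  constructor
  · apply key
    rw [← trace_def, algebraMap_trace_eq_add_star]
    exact hz.add hs
  · apply key
    rw [algebraMap_norm_eq_mul_star]
    exact hz.mul hs

theorem int_of_quad {R : Type*} [CommRing R] (x : R) (t n : ℤ) (h : x ^ 2 = t * x - n) :
    IsIntegral ℤ x := by
  refine ⟨Polynomial.X ^ 2 - Polynomial.C t * Polynomial.X + Polynomial.C n, ?_, ?_⟩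
  · monicity!
  · simp only [Polynomial.eval₂_add, Polynomial.eval₂_sub, Polynomial.eval₂_mul,
      Polynomial.eval₂_pow, Polynomial.eval₂_X, Polynomial.eval₂_C, h]
    simp

/-- A quadratic field generated by a root. -/
theorem exists_equiv {K : Type*} [Field K] [NumberField K] (hdeg : Module.finrank ℚ K = 2)
    {a b : ℚ} [Fact (∀ r : ℚ, r ^ 2 ≠ a + b * r)] (u : K) (hu : u * u = a • 1 + b • u) :
    ∃ e : QuadraticAlgebra ℚ a b ≃ₐ[ℚ] K, ∀ p q : ℚ, e ⟨p, q⟩ = p + q * u := by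
  let f := QuadraticAlgebra.lift (⟨u, hu⟩ : { u : K // u * u = a • 1 + b • u })
  have hf : ∀ p q : ℚ, f ⟨p, q⟩ = p + q * u := by
    intro p q
    simp [f, QuadraticAlgebra.lift, Algebra.smul_def]
  have hinj : Function.Injective f := f.toRingHom.injective
  have : FiniteDimensional ℚ (QuadraticAlgebra ℚ a b) :=
    Module.finite_of_finrank_pos (by rw [QuadraticAlgebra.finrank_eq_two]; norm_num)
  have hb : Function.Bijective f := by
    refine ⟨hinj, ?_⟩
    exact (LinearMap.injective_iff_surjective_of_finrank_eq_finrank (f := f.toLinearMap)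
      (by rw [hdeg, QuadraticAlgebra.finrank_eq_two])).1 hinj
  exact ⟨AlgEquiv.ofBijective f hb, fun p q => hf p q⟩

theorem F_int (z : F) (hz : IsIntegral ℤ z) : ∃ y : O, z = io y := by
  obtain ⟨⟨t, ht⟩, n, hn⟩ := tr_norm_int z hz
  rw [F_norm] at hn
  obtain ⟨q, hq⟩ := sqf_rat (d := 5) (Int.prime_iff_natAbs_prime.2 (by norm_num)).squarefree z.im
    (t ^ 2 - 4 * n) (by push_cast; rw [← ht, ← hn]; ring)
  have h1 : t ^ 2 - 5 * q ^ 2 = 4 * n := by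
    have : (t : ℚ) ^ 2 - 5 * q ^ 2 = 4 * n := by
      rw [← ht, ← hn, ← hq]; ring
    exact_mod_cast this
  have h2 : ∃ p, t - q = 2 * p := by
    have : Even (t ^ 2 - 5 * q ^ 2) := by rw [h1]; exact ⟨2 * n, by ring⟩
    have h3 : Even (t - q) := by
      simp only [Int.even_sub, Int.even_mul, Int.even_pow] at this ⊢
      have h5 : ¬ Even (5 : ℤ) := by decide
      tauto
    obtain ⟨p, hp⟩ := h3
    exact ⟨p, by omega⟩
  obtain ⟨p, hp⟩ := h2
  refine ⟨⟨p, q⟩, ?_⟩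
  ext
  · rw [io_re]
    have : (t : ℚ) - q = 2 * p := by exact_mod_cast hp
    rw [← ht, hq] at this
    show z.re = p
    linarith
  · exact hq

theorem back {K : Type*} [Field K] [NumberField K] (hdeg : Module.finrank ℚ K = 2)
    (r : K) (hr : r ^ 2 = 5) (m : 𝓞 K) (hm : ∀ φ : K →+* ℝ, 0 < φ (m : K)) :
    ∃ x₁ x₂ x₃ x₄ : 𝓞 K, m = x₁ ^ 2 + x₂ ^ 2 + x₃ ^ 2 + x₄ ^ 2 := by
  obtain ⟨e, he⟩ := exists_equiv hdeg (a := 1) (b := 1) ((1 + r) / 2)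
    (by simp only [one_smul]; linear_combination hr / 4)
  have hz : IsIntegral ℤ (e.symm (m : K)) :=
    map_isIntegral_int (e.symm : K →+* F) (RingOfIntegers.isIntegral_coe m)
  obtain ⟨y, hy⟩ := F_int _ hz
  have hT : TP (io y) := by
    rw [← hy]
    exact ⟨hm (e1.comp (e.symm : K →+* F)), hm (e2.comp (e.symm : K →+* F))⟩
  obtain ⟨a, b, c, d, h⟩ := universal_O _ y rfl hT
  have hO : ∀ x : O, IsIntegral ℤ (e (io x)) := by
    intro x
    have : IsIntegral ℤ x := by
      refine int_of_quad x (2 * x.re + x.im) (QuadraticAlgebra.norm x) ?_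
      rw [O_norm]
      ext <;> simp [sq] <;> ring
    exact map_isIntegral_int ((e : F →+* K).comp io) this
  refine ⟨⟨_, hO a⟩, ⟨_, hO b⟩, ⟨_, hO c⟩, ⟨_, hO d⟩, ?_⟩
  apply RingOfIntegers.ext
  have : (m : K) = e (io y) := by rw [← hy]; simp
  rw [this, h]
  simp only [map_add, map_pow]
  rfl

end FourSq

namespace FourSq
open QuadraticAlgebra

theorem exists_sqrt {K : Type*} [Field K] [NumberField K] (hdeg : Module.finrank ℚ K = 2)
    (φ : K →+* ℝ) : ∃ d : ℤ, Squarefree d ∧ 1 < d ∧ ∃ θ : K, θ ^ 2 = d := by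
  obtain ⟨x, hx⟩ : ∃ x : K, x ∉ (algebraMap ℚ K).range := by
    by_contra! h
    have : (⊥ : Subalgebra ℚ K) = ⊤ := by
      rw [eq_top_iff]
      intro x _
      exact Algebra.mem_bot.2 (h x)
    rw [Subalgebra.bot_eq_top_iff_finrank_eq_one] at this
    omega
  have hxi : IsIntegral ℚ x := Algebra.IsIntegral.isIntegral x
  have h2 : (minpoly ℚ x).natDegree = 2 := by
    apply le_antisymm
    · rw [← hdeg]; exact minpoly.natDegree_le x
    · exact (minpoly.two_le_natDegree_iff hxi).2 hx
  have h3 := minpoly.aeval ℚ x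
  have h4 := minpoly.monic hxi
  rw [Polynomial.Monic, Polynomial.leadingCoeff, h2] at h4
  rw [Polynomial.aeval_eq_sum_range, h2] at h3
  simp only [Finset.sum_range_succ, Finset.sum_range_zero, h4, Algebra.smul_def] at h3
  obtain ⟨b, hb⟩ : ∃ b, b = (minpoly ℚ x).coeff 1 := ⟨_, rfl⟩
  obtain ⟨c, hc⟩ : ∃ c, c = (minpoly ℚ x).coeff 0 := ⟨_, rfl⟩
  rw [← hb, ← hc] at h3
  simp only [eq_ratCast, map_one] at h3
  have hQ : ∀ q : ℚ, (q : K) ∈ (algebraMap ℚ K).range := fun q => ⟨q, by simp⟩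
  obtain ⟨D, hD⟩ : ∃ D : ℚ, D = b ^ 2 - 4 * c := ⟨_, rfl⟩
  have hy : (2 * x + b) ^ 2 = D := by
    rw [hD]; push_cast; linear_combination 4 * h3
  have hyr : ∀ q : ℚ, 2 * x + b ≠ q := by
    intro q hq
    apply hx
    have : x = ((q - b) / 2 : ℚ) := by
      push_cast; rw [← hq]; ring
    rw [this]; exact hQ _
  obtain ⟨w, hw⟩ : ∃ w, w = (D.den : K) * (2 * x + b) := ⟨_, rfl⟩
  have hden : (D.den : K) ≠ 0 := by exact_mod_cast D.den_nz
  have hDd : (D : K) * D.den = D.num := by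
    have := Rat.mul_den_eq_num D
    exact_mod_cast congrArg (fun q : ℚ => (q : K)) this
  have hw2 : w ^ 2 = ((D.num * D.den : ℤ) : K) := by
    rw [hw, mul_pow, hy]; push_cast; rw [← hDd]; ring
  have hwr : ∀ q : ℚ, w ≠ q := by
    intro q hq
    apply hyr (q / D.den)
    push_cast
    rw [← hq, hw]; field_simp
  obtain ⟨N, hN⟩ : ∃ N : ℤ, N = D.num * D.den := ⟨_, rfl⟩
  rw [← hN] at hw2
  have hw0 : w ≠ 0 := by simpa using hwr 0
  have hN0 : 0 < N := by
    have h5 : (φ w) ^ 2 = N := by rw [← map_pow, hw2]; simp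
    have h6 : 0 < (φ w) ^ 2 := by
      have : φ w ≠ 0 := by simpa using hw0
      positivity
    rw [h5] at h6
    exact_mod_cast h6
  obtain ⟨a, k, hak, hsq⟩ := Nat.sq_mul_squarefree N.toNat
  have hak' : (k : ℤ) ^ 2 * a = N := by
    have : ((k ^ 2 * a : ℕ) : ℤ) = N := by rw [hak]; omega
    exact_mod_cast this
  have hk0 : (k : K) ≠ 0 := by
    intro h
    have : k = 0 := by exact_mod_cast h
    rw [this] at hak'; simp at hak'; omega
  have hth : (w / k) ^ 2 = ((a : ℤ) : K) := by
    rw [div_pow, hw2, ← hak']; push_cast; field_simp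
  refine ⟨a, Int.squarefree_natCast.2 hsq, ?_, w / k, hth⟩
  have ha0 : a ≠ 0 := hsq.ne_zero
  have ha1 : a ≠ 1 := by
    intro h
    rw [h] at hth
    simp at hth
    rcases hth with h | h
    · apply hwr k; field_simp at h; simpa using h
    · apply hwr (-k); field_simp at h; simpa using h
  omega

theorem fact_sqf {d : ℤ} (hd : Squarefree d) (h1 : 1 < d) :
    Fact (∀ r : ℚ, r ^ 2 ≠ (d : ℚ) + 0 * r) := ⟨by
  intro r h
  obtain ⟨n, rfl⟩ := sqf_rat (d := 1) squarefree_one r d (by simpa using h)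
  have h2 : n * n = d := by
    rw [← sq]; simpa using (by exact_mod_cast h : n ^ 2 = d + 0 * n)
  have := hd n ⟨1, by rw [h2, mul_one]⟩
  rcases Int.isUnit_iff.1 this with h | h <;> subst h <;> omega⟩

theorem sqp (u v w z u' v' w' z' : ℤ) (h : u * u' + v * v' + w * w' + z * z' = 1) :
    1 ≤ u ^ 2 + v ^ 2 + w ^ 2 + z ^ 2 := by
  by_contra! hlt
  have e0 : ∀ t : ℤ, t ^ 2 ≤ 0 → t = 0 := by
    intro t ht
    exact pow_eq_zero_iff (two_ne_zero) |>.1 (le_antisymm ht (sq_nonneg t))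
  have h1 := sq_nonneg u
  have h2 := sq_nonneg v
  have h3 := sq_nonneg w
  have h4 := sq_nonneg z
  rw [e0 u (by linarith), e0 v (by linarith), e0 w (by linarith), e0 z (by linarith)] at h
  simp at h

set_option maxHeartbeats 1000000 in
theorem forward {K : Type*} [Field K] [NumberField K] (hdeg : Module.finrank ℚ K = 2)
    (φ : K →+* ℝ)
    (H : ∀ m : 𝓞 K, (∀ φ : K →+* ℝ, 0 < φ (m : K)) →
        ∃ x₁ x₂ x₃ x₄ : 𝓞 K, m = x₁ ^ 2 + x₂ ^ 2 + x₃ ^ 2 + x₄ ^ 2) :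
    ∃ r : K, r ^ 2 = 5 := by
  obtain ⟨d, hsq, hd1, θ, hθ⟩ := exists_sqrt hdeg φ
  have := fact_sqf hsq hd1
  obtain ⟨e, he⟩ := exists_equiv hdeg (a := (d : ℚ)) (b := 0) θ (by
    rw [← sq, hθ, zero_smul, add_zero, Algebra.smul_def]; simp)
  have coord : ∀ p q p' q' : ℤ, (p : K) + q * θ = p' + q' * θ → p = p' ∧ q = q' := by
    intro p q p' q' h
    have : e ⟨p, q⟩ = e ⟨p', q'⟩ := by rw [he, he]; simpa using h
    have := e.injective this
    simpa using this
  have form : ∀ x : 𝓞 K, ∃ a b n : ℤ, 2 * (x : K) = a + b * θ ∧ a ^ 2 - d * b ^ 2 = 4 * n := by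
    intro x
    have hz : IsIntegral ℤ (e.symm (x : K)) :=
      map_isIntegral_int (e.symm : K →+* QuadraticAlgebra ℚ (d : ℚ) 0)
        (RingOfIntegers.isIntegral_coe x)
    obtain ⟨z, hzz⟩ : ∃ z, z = e.symm (x : K) := ⟨_, rfl⟩
    rw [← hzz] at hz
    obtain ⟨⟨t, ht⟩, n, hn⟩ := tr_norm_int z hz
    rw [norm_def] at hn
    obtain ⟨q, hq⟩ := sqf_rat hsq (2 * z.im) (t ^ 2 - 4 * n)
      (by push_cast; rw [← ht, ← hn]; ring)
    refine ⟨t, q, n, ?_, ?_⟩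
    · have h1 : (x : K) = z.re + z.im * θ := by
        rw [← he]; change _ = e z; rw [hzz]; simp
      have h2 : (t : K) = 2 * z.re := by
        have : ((t : ℚ) : K) = ((2 * z.re + 0 * z.im : ℚ) : K) := by rw [ht]
        simpa using this
      have h3 : (q : K) = 2 * z.im := by
        have : ((q : ℚ) : K) = ((2 * z.im : ℚ) : K) := by rw [hq]
        simpa using this
      rw [h1, h2, h3]; ring
    · have : (t : ℚ) ^ 2 - d * q ^ 2 = 4 * n := by
        rw [← ht, ← hn, ← hq]; ring
      exact_mod_cast this
  have hφθ : ∀ ψ : K →+* ℝ, (ψ θ) ^ 2 = d := by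
    intro ψ; rw [← map_pow, hθ]; simp
  by_cases h4 : d % 4 = 1
  · by_contra hne
    have hd5 : d ≠ 5 := by
      intro h; exact hne ⟨θ, by rw [hθ, h]; simp⟩
    obtain ⟨s, hs⟩ : ∃ s, s = Int.sqrt d := ⟨_, rfl⟩
    have hs0 : 0 ≤ s := hs ▸ Int.sqrt_nonneg d
    have hs1 : s * s ≤ d := by
      have := Nat.sqrt_le d.toNat
      rw [hs, Int.sqrt]
      zify at this; rwa [Int.toNat_of_nonneg (by omega)] at this
    have hs2 : d < (s + 1) * (s + 1) := by
      have := Nat.lt_succ_sqrt d.toNat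
      rw [hs, Int.sqrt]
      zify at this; rwa [Int.toNat_of_nonneg (by omega)] at this
    obtain ⟨A, hA1, hA2, hA3⟩ : ∃ A : ℤ, s + 1 ≤ A ∧ A ≤ s + 2 ∧ A % 2 = 1 := by
      rcases Int.emod_two_eq_zero_or_one s with h | h
      · exact ⟨s + 1, by omega, by omega, by omega⟩
      · exact ⟨s + 2, by omega, by omega, by omega⟩
    have hAd : d < A * A := by nlinarith
    obtain ⟨n, hn⟩ : ∃ n, A * A - d = 4 * n := by
      obtain ⟨k, hk⟩ : ∃ k, A = 2 * k + 1 := ⟨A / 2, by omega⟩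
      refine ⟨k * k + k - d / 4, ?_⟩
      have : d = 4 * (d / 4) + 1 := by omega
      rw [hk]; linarith
    have hnK : (A : K) * A - d = 4 * n := by exact_mod_cast congrArg (fun z : ℤ => (z : K)) hn
    have hInt : IsIntegral ℤ (((A : K) + θ) / 2) := by
      refine int_of_quad _ A n ?_
      linear_combination hθ / 4 - hnK / 4
    obtain ⟨x1, x2, x3, x4, hx⟩ := H ⟨_, hInt⟩ (by
      intro ψ
      have h1 := hφθ ψ
      have h2 : (d : ℝ) < A * A := by exact_mod_cast hAd
      have h3 : (0 : ℝ) < A := by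
        have : 0 < A := by omega
        exact_mod_cast this
      have h4 : |ψ θ| < A := abs_lt_of_sq_lt_sq (by rw [h1]; nlinarith) h3.le
      have := (abs_lt.1 h4).1
      change 0 < ψ (((A : K) + θ) / 2)
      rw [map_div₀, map_add, map_ofNat, map_intCast]
      linarith)
    obtain ⟨a1, b1, -, h1, -⟩ := form x1
    obtain ⟨a2, b2, -, h2, -⟩ := form x2
    obtain ⟨a3, b3, -, h3, -⟩ := form x3
    obtain ⟨a4, b4, -, h4, -⟩ := form x4
    have hxK : ((A : K) + θ) / 2 = (x1 : K) ^ 2 + (x2 : K) ^ 2 + (x3 : K) ^ 2 + (x4 : K) ^ 2 := by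
      have := congrArg (fun z : 𝓞 K => (z : K)) hx
      simp only [map_add, map_pow] at this
      exact this
    have hc := coord (2 * A) 2
      (a1 ^ 2 + a2 ^ 2 + a3 ^ 2 + a4 ^ 2 + d * (b1 ^ 2 + b2 ^ 2 + b3 ^ 2 + b4 ^ 2))
      (2 * (a1 * b1 + a2 * b2 + a3 * b3 + a4 * b4)) (by
        have h5 : 2 * ((A : K) + θ) = (2 * (x1 : K)) ^ 2 + (2 * (x2 : K)) ^ 2 + (2 * (x3 : K)) ^ 2
            + (2 * (x4 : K)) ^ 2 := by linear_combination 4 * hxK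
        rw [h1, h2, h3, h4] at h5
        push_cast
        linear_combination h5 + (b1 ^ 2 + b2 ^ 2 + b3 ^ 2 + b4 ^ 2 : K) * hθ)
    obtain ⟨hc1, hc2⟩ := hc
    have hp1 := sqp a1 a2 a3 a4 b1 b2 b3 b4 (by linarith)
    have hp2 := sqp b1 b2 b3 b4 a1 a2 a3 a4 (by linarith)
    have hp3 := mul_le_mul_of_nonneg_left hp2 (by omega : 0 ≤ d)
    have hle : 1 + d ≤ 2 * A := by linarith
    have hs4 : s < 4 := by nlinarith
    have hd9 : d ≠ 9 := by
      intro h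
      have := hsq 3 ⟨1, by rw [h]; norm_num⟩
      rcases Int.isUnit_iff.1 this with h | h <;> omega
    interval_cases s <;> omega
  · exfalso
    have h40 : d % 4 ≠ 0 := by
      intro h
      have := hsq 2 ⟨d / 4, by omega⟩
      rcases Int.isUnit_iff.1 this with h | h <;> omega
    have par : ∀ a b n : ℤ, a ^ 2 - d * b ^ 2 = 4 * n → ∃ a' b', a = 2 * a' ∧ b = 2 * b' := by
      intro a b n h
      obtain ⟨k, c, hk, hc⟩ : ∃ k c, d = 4 * k + c ∧ (c = 2 ∨ c = 3) :=
        ⟨d / 4, d % 4, by omega, by omega⟩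
      obtain ⟨a', ha⟩ := Int.even_or_odd' a
      obtain ⟨b', hb⟩ := Int.even_or_odd' b
      refine ⟨a', b', ?_⟩
      rcases ha with ha | ha <;> rcases hb with hb | hb
      · exact ⟨ha, hb⟩
      all_goals
        exfalso
        rw [ha, hb, hk] at h
        ring_nf at h
        rcases hc with rfl | rfl <;> omega
    have hInt : IsIntegral ℤ ((d : K) + θ) := by
      refine int_of_quad _ (2 * d) (d ^ 2 - d) ?_
      push_cast
      linear_combination hθ
    obtain ⟨x1, x2, x3, x4, hx⟩ := H ⟨_, hInt⟩ (by
      intro ψ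
      have h1 := hφθ ψ
      have h3 : (1 : ℝ) < d := by exact_mod_cast hd1
      have h4 : |ψ θ| < d := abs_lt_of_sq_lt_sq (by rw [h1]; nlinarith) (by linarith)
      have := (abs_lt.1 h4).1
      change 0 < ψ ((d : K) + θ)
      rw [map_add, map_intCast]
      linarith)
    have form' : ∀ x : 𝓞 K, ∃ a b : ℤ, (x : K) = a + b * θ := by
      intro x
      obtain ⟨a, b, n, h, hn⟩ := form x
      obtain ⟨a', b', rfl, rfl⟩ := par a b n hn
      refine ⟨a', b', ?_⟩
      push_cast at h
      linear_combination h / 2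
    obtain ⟨a1, b1, h1⟩ := form' x1
    obtain ⟨a2, b2, h2⟩ := form' x2
    obtain ⟨a3, b3, h3⟩ := form' x3
    obtain ⟨a4, b4, h4⟩ := form' x4
    have hxK : (d : K) + θ = (x1 : K) ^ 2 + (x2 : K) ^ 2 + (x3 : K) ^ 2 + (x4 : K) ^ 2 := by
      have := congrArg (fun z : 𝓞 K => (z : K)) hx
      simp only [map_add, map_pow] at this
      exact this
    have hc := coord d 1
      (a1 ^ 2 + a2 ^ 2 + a3 ^ 2 + a4 ^ 2 + d * (b1 ^ 2 + b2 ^ 2 + b3 ^ 2 + b4 ^ 2))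
      (2 * (a1 * b1 + a2 * b2 + a3 * b3 + a4 * b4)) (by
        rw [h1, h2, h3, h4] at hxK
        push_cast
        linear_combination hxK + (b1 ^ 2 + b2 ^ 2 + b3 ^ 2 + b4 ^ 2 : K) * hθ)
    omega

end FourSq

/-- among real quadratic fields `K`, the form `x₁²+x₂²+x₃²+x₄²` is
universal over `O_K` (represents every totally positive integer) iff
`K = ℚ(√5)`, i.e. iff `K` contains a square root of `5`. -/
theorem four_squares_universal_iff_sqrt5
    (K : Type*) [Field K] [NumberField K]
    (hdeg : Module.finrank ℚ K = 2) (hreal : Nonempty (K →+* ℝ)) :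
    (∀ m : 𝓞 K, (∀ φ : K →+* ℝ, 0 < φ (m : K)) →
        ∃ x₁ x₂ x₃ x₄ : 𝓞 K, m = x₁ ^ 2 + x₂ ^ 2 + x₃ ^ 2 + x₄ ^ 2) ↔
      ∃ r : K, r ^ 2 = 5 := by
  constructor
  · intro H
    obtain ⟨φ⟩ := hreal
    exact FourSq.forward hdeg φ H
  · rintro ⟨r, hr⟩ m hm
    exact FourSq.back hdeg r hr m hm
end
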